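/- Let X be a projective variety over an infinite field k, φ: X → X a morphism, and L a very ample line bundle on X with φ*(L) ≅ L^{⊗d} for some d > 1. Let V = H^0(X, L) and suppose: (1) the embedding ι: X → P(V) induced by L has the property that the restriction maps H^0(P(V), O(n)) → H^0(X, L^{⊗n}) are surjective for all n ≥ 0, and (2) ι(X) is cut out set-theoretically by homogeneous forms of degree ≤ d. Then there exists a morphism ψ: P(V) → P(V) such that ψ ∘ ι = ι ∘ φ. -/

import Mathlib

open AlgebraicGeometry CategoryTheory CategoryTheory.Limits Opposite

noncomputable section

universe u

/-- Restriction of sections of the structure sheaf, as a ring homomorphism. -/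
def sres (X : Scheme.{u}) {V W : X.Opens} (h : V ≤ W) : Γ(X, W) →+* Γ(X, V) :=
  (X.presheaf.map (homOfLE h).op : Γ(X, W) ⟶ Γ(X, V)).hom

lemma sres_sres (X : Scheme.{u}) {V W T : X.Opens} (h₁ : V ≤ W) (h₂ : W ≤ T) (a : Γ(X, T)) :
    sres X h₁ (sres X h₂ a) = sres X (h₁.trans h₂) a := by
  have : (homOfLE (h₁.trans h₂)).op = (homOfLE h₂).op ≫ (homOfLE h₁).op := rfl
  simp only [sres, this, Functor.map_comp]
  rfl

/-- A line bundle (invertible sheaf) on a scheme `X`, presented by an open cover and a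
Čech `1`-cocycle of transition units. -/
structure LineBundle (X : Scheme.{u}) where
  ι : Type u
  U : ι → X.Opens
  covers : iSup U = ⊤
  t : ∀ i j, (Γ(X, U i ⊓ U j))ˣ
  cocycle : ∀ i j l,
    Units.map (sres X (show U i ⊓ U j ⊓ U l ≤ U i ⊓ U j from inf_le_left)).toMonoidHom (t i j)
      * Units.map (sres X (show U i ⊓ U j ⊓ U l ≤ U j ⊓ U l from
          le_inf (inf_le_left.trans inf_le_right) inf_le_right)).toMonoidHom (t j l)
    = Units.map (sres X (show U i ⊓ U j ⊓ U l ≤ U i ⊓ U l from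
          le_inf (inf_le_left.trans inf_le_left) inf_le_right)).toMonoidHom (t i l)

namespace LineBundle

variable {X Y : Scheme.{u}}

/-- The `n`-th tensor power of a line bundle. -/
def pow (L : LineBundle X) (n : ℕ) : LineBundle X where
  ι := L.ι
  U := L.U
  covers := L.covers
  t i j := L.t i j ^ n
  cocycle i j l := by
    simp only [map_pow, ← mul_pow, L.cocycle i j l]

/-- The dual (inverse) of a line bundle. -/
def dual (L : LineBundle X) : LineBundle X where
  ι := L.ι
  U := L.U
  covers := L.covers
  t i j := (L.t i j)⁻¹
  cocycle i j l := by
    simp only [map_inv, ← mul_inv, L.cocycle i j l]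

/-- The trivial line bundle. -/
def trivial (X : Scheme.{u}) : LineBundle X where
  ι := PUnit
  U _ := ⊤
  covers := by simp
  t _ _ := 1
  cocycle _ _ _ := by simp

lemma unit_sres_sres (X : Scheme.{u}) {V W T : X.Opens} (h₁ : V ≤ W) (h₂ : W ≤ T)
    (u : (Γ(X, T))ˣ) :
    Units.map (sres X h₁).toMonoidHom (Units.map (sres X h₂).toMonoidHom u)
      = Units.map (sres X (h₁.trans h₂)).toMonoidHom u := by
  ext
  exact sres_sres X h₁ h₂ u

/-- The tensor product of two line bundles. -/
def tensor (L M : LineBundle X) : LineBundle X where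
  ι := L.ι × M.ι
  U p := L.U p.1 ⊓ M.U p.2
  covers := by
    apply le_antisymm le_top
    have h : (⊤ : X.Opens) = (⨆ i, L.U i) ⊓ ⨆ j, M.U j := by
      rw [L.covers, M.covers, top_inf_eq]
    rw [h, iSup_inf_eq]
    refine iSup_le fun i => ?_
    rw [inf_iSup_eq]
    exact iSup_le fun j => le_iSup_of_le (i, j) le_rfl
  t p q :=
    Units.map (sres X (show (L.U p.1 ⊓ M.U p.2) ⊓ (L.U q.1 ⊓ M.U q.2) ≤ L.U p.1 ⊓ L.U q.1 from
        le_inf (inf_le_left.trans inf_le_left) (inf_le_right.trans inf_le_left))).toMonoidHom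
      (L.t p.1 q.1) *
    Units.map (sres X (show (L.U p.1 ⊓ M.U p.2) ⊓ (L.U q.1 ⊓ M.U q.2) ≤ M.U p.2 ⊓ M.U q.2 from
        le_inf (inf_le_left.trans inf_le_right) (inf_le_right.trans inf_le_right))).toMonoidHom
      (M.t p.2 q.2)
  cocycle p q r := by
    simp only [map_mul, unit_sres_sres]
    have hL := congrArg (Units.map (sres X (show
        (L.U p.1 ⊓ M.U p.2) ⊓ (L.U q.1 ⊓ M.U q.2) ⊓ (L.U r.1 ⊓ M.U r.2) ≤
          L.U p.1 ⊓ L.U q.1 ⊓ L.U r.1 from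
        le_inf (le_inf (inf_le_left.trans (inf_le_left.trans inf_le_left))
          (inf_le_left.trans (inf_le_right.trans inf_le_left)))
          (inf_le_right.trans inf_le_left))).toMonoidHom) (L.cocycle p.1 q.1 r.1)
    have hM := congrArg (Units.map (sres X (show
        (L.U p.1 ⊓ M.U p.2) ⊓ (L.U q.1 ⊓ M.U q.2) ⊓ (L.U r.1 ⊓ M.U r.2) ≤
          M.U p.2 ⊓ M.U q.2 ⊓ M.U r.2 from
        le_inf (le_inf (inf_le_left.trans (inf_le_left.trans inf_le_right))
          (inf_le_left.trans (inf_le_right.trans inf_le_right)))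
          (inf_le_right.trans inf_le_right))).toMonoidHom) (M.cocycle p.2 q.2 r.2)
    simp only [map_mul, unit_sres_sres] at hL hM
    rw [mul_mul_mul_comm, hL, hM]

lemma preimage_mono (f : X ⟶ Y) {U U' : Y.Opens} (h : U ≤ U') : f ⁻¹ᵁ U ≤ f ⁻¹ᵁ U' :=
  fun _ hx => h hx

lemma unit_sres_appLE (f : X ⟶ Y) {U : Y.Opens} {V V' : X.Opens} (e : V ≤ f ⁻¹ᵁ U)
    (h : V' ≤ V) (u : (Γ(Y, U))ˣ) :
    Units.map (sres X h).toMonoidHom (Units.map (f.appLE U V e).hom.toMonoidHom u)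
      = Units.map (f.appLE U V' (h.trans e)).hom.toMonoidHom u := by
  ext
  show sres X h (f.appLE U V e u) = f.appLE U V' (h.trans e) u
  rw [show f.appLE U V' (h.trans e)
      = f.appLE U V e ≫ X.presheaf.map (homOfLE h).op from (f.appLE_map e (homOfLE h).op).symm]
  rfl

lemma unit_appLE_sres (f : X ⟶ Y) {U U' : Y.Opens} {V : X.Opens} (e : V ≤ f ⁻¹ᵁ U)
    (h : U ≤ U') (u : (Γ(Y, U'))ˣ) :
    Units.map (f.appLE U V e).hom.toMonoidHom (Units.map (sres Y h).toMonoidHom u)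
      = Units.map (f.appLE U' V (e.trans (preimage_mono f h))).hom.toMonoidHom u := by
  ext
  show f.appLE U V e (sres Y h u) = f.appLE U' V _ u
  rw [show f.appLE U' V (e.trans (preimage_mono f h))
      = Y.presheaf.map (homOfLE h).op ≫ f.appLE U V e from (f.map_appLE e (homOfLE h).op).symm]
  rfl

lemma preimage_inf (f : X ⟶ Y) (U V : Y.Opens) :
    f ⁻¹ᵁ (U ⊓ V) = f ⁻¹ᵁ U ⊓ f ⁻¹ᵁ V := by
  ext x; simp

set_option maxHeartbeats 1000000 in
/-- The pullback of a line bundle along a morphism of schemes. -/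
def pullbackLB (f : X ⟶ Y) (L : LineBundle Y) : LineBundle X where
  ι := L.ι
  U i := f ⁻¹ᵁ L.U i
  covers := by
    have : (⨆ i, f ⁻¹ᵁ L.U i) = f ⁻¹ᵁ (⨆ i, L.U i) := by
      ext x
      simp [TopologicalSpace.Opens.mem_iSup]
    rw [this, L.covers]
    rfl
  t i j :=
    Units.map (f.appLE (L.U i ⊓ L.U j) (f ⁻¹ᵁ L.U i ⊓ f ⁻¹ᵁ L.U j)
      (preimage_inf f (L.U i) (L.U j)).ge).hom.toMonoidHom (L.t i j)
  cocycle i j l := by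
    have key := congrArg (Units.map (f.appLE (L.U i ⊓ L.U j ⊓ L.U l)
        (f ⁻¹ᵁ L.U i ⊓ f ⁻¹ᵁ L.U j ⊓ f ⁻¹ᵁ L.U l)
        (le_of_eq (show f ⁻¹ᵁ L.U i ⊓ f ⁻¹ᵁ L.U j ⊓ f ⁻¹ᵁ L.U l
            = f ⁻¹ᵁ (L.U i ⊓ L.U j ⊓ L.U l) by
          rw [preimage_inf, preimage_inf]))).hom.toMonoidHom)
      (L.cocycle i j l)
    rw [map_mul] at key
    rw [unit_sres_appLE, unit_sres_appLE, unit_sres_appLE]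
    rw [unit_appLE_sres, unit_appLE_sres, unit_appLE_sres] at key
    exact key

/-- A global section of a line bundle: compatible local sections with respect to the
transition cocycle. -/
@[ext]
structure GlobalSec {X : Scheme.{u}} (L : LineBundle X) where
  s : ∀ i, Γ(X, L.U i)
  compat : ∀ i j, sres X (inf_le_left : L.U i ⊓ L.U j ≤ L.U i) (s i)
    = (L.t i j : Γ(X, L.U i ⊓ L.U j)) * sres X inf_le_right (s j)

/-- The open locus where a global section of a line bundle does not vanish. -/
def GlobalSec.locus {X : Scheme.{u}} {L : LineBundle X} (σ : GlobalSec L) : X.Opens :=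
  ⨆ i, X.basicOpen (σ.s i)

/-- A line bundle `L` on a scheme `X` is ample if `X` is quasi-compact and every point has
an affine neighbourhood of the form `X_s` for a global section `s` of some positive tensor
power of `L`. -/
def IsAmple {X : Scheme.{u}} (L : LineBundle X) : Prop :=
  CompactSpace X ∧ ∀ x : X, ∃ (m : ℕ) (_ : 0 < m) (σ : GlobalSec (L.pow m)),
    x ∈ σ.locus ∧ IsAffineOpen σ.locus

/-- Two line bundles are isomorphic iff on a common refinement of their trivialising covers
their transition cocycles differ by a coboundary. -/
def EquivLB {X : Scheme.{u}} (L M : LineBundle X) : Prop :=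
  ∃ (κ : Type u) (V : κ → X.Opens) (_ : iSup V = ⊤) (a : κ → L.ι) (b : κ → M.ι)
    (ha : ∀ c, V c ≤ L.U (a c)) (hb : ∀ c, V c ≤ M.U (b c)) (s : ∀ c, (Γ(X, V c))ˣ),
    ∀ c c' : κ,
      Units.map (sres X (le_inf ((inf_le_left.trans (ha c)))
          (inf_le_right.trans (ha c')) : V c ⊓ V c' ≤ L.U (a c) ⊓ L.U (a c'))).toMonoidHom
          (L.t (a c) (a c'))
        * Units.map (sres X (inf_le_right : V c ⊓ V c' ≤ V c')).toMonoidHom (s c')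
      = Units.map (sres X (inf_le_left : V c ⊓ V c' ≤ V c)).toMonoidHom (s c)
        * Units.map (sres X (le_inf ((inf_le_left.trans (hb c)))
            (inf_le_right.trans (hb c')))).toMonoidHom (M.t (b c) (b c'))

/-- The canonical algebra map `k → Γ(X, U)` for a scheme `X` over `Spec k`. -/
def toSections {k : Type u} [Field k] {X : Scheme.{u}} (sX : X ⟶ Spec (CommRingCat.of k))
    (U : X.Opens) : k →+* Γ(X, U) :=
  ((sres X (le_top : U ≤ ⊤)).comp
    ((sX.appTop.hom : Γ(Spec (CommRingCat.of k), ⊤) →+* Γ(X, ⊤)))).comp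
    ((Scheme.ΓSpecIso (CommRingCat.of k)).inv : CommRingCat.of k ⟶ _).hom

lemma sres_toSections {k : Type u} [Field k] {X : Scheme.{u}}
    (sX : X ⟶ Spec (CommRingCat.of k)) {V U : X.Opens} (h : V ≤ U) (c : k) :
    sres X h (toSections sX U c) = toSections sX V c := by
  simp only [toSections, RingHom.comp_apply, sres_sres]

/-- The space of global sections of a line bundle on a scheme over `k`, as a `k`-submodule
of the product of the local section spaces. -/
def secSubmodule {k : Type u} [Field k] {X : Scheme.{u}} (sX : X ⟶ Spec (CommRingCat.of k))
    (L : LineBundle X) :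
    letI : ∀ i, Module k Γ(X, L.U i) := fun i => (toSections sX (L.U i)).toModule
    Submodule k (∀ i, Γ(X, L.U i)) :=
  letI : ∀ i, Module k Γ(X, L.U i) := fun i => (toSections sX (L.U i)).toModule
  { carrier := {s | ∀ i j, sres X (inf_le_left : L.U i ⊓ L.U j ≤ L.U i) (s i)
      = (L.t i j : Γ(X, L.U i ⊓ L.U j)) * sres X inf_le_right (s j)}
    add_mem' := by
      intro s r hs hr i j
      simp only [Pi.add_apply, map_add, hs i j, hr i j, mul_add]
    zero_mem' := by
      intro i j
      simp
    smul_mem' := by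
      intro c s hs i j
      show sres X _ (toSections sX (L.U i) c * s i)
        = (L.t i j : Γ(X, L.U i ⊓ L.U j)) * sres X _ (toSections sX (L.U j) c * s j)
      rw [map_mul, map_mul, hs i j, sres_toSections, sres_toSections]
      ring }

/-- The dimension `h⁰(X, L)` of the space of global sections of a line bundle on a scheme
over a field `k`. -/
def h0 {k : Type u} [Field k] {X : Scheme.{u}} (sX : X ⟶ Spec (CommRingCat.of k))
    (L : LineBundle X) : ℕ :=
  letI : ∀ i, Module k Γ(X, L.U i) := fun i => (toSections sX (L.U i)).toModule
  Module.finrank k (secSubmodule sX L)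

lemma sres_appLE (f : X ⟶ Y) {U : Y.Opens} {V V' : X.Opens} (e : V ≤ f ⁻¹ᵁ U)
    (h : V' ≤ V) (a : Γ(Y, U)) :
    sres X h (f.appLE U V e a) = f.appLE U V' (h.trans e) a := by
  rw [show f.appLE U V' (h.trans e)
      = f.appLE U V e ≫ X.presheaf.map (homOfLE h).op from (f.appLE_map e (homOfLE h).op).symm]
  rfl

lemma appLE_sres (f : X ⟶ Y) {U U' : Y.Opens} {V : X.Opens} (e : V ≤ f ⁻¹ᵁ U)
    (h : U ≤ U') (a : Γ(Y, U')) :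
    f.appLE U V e (sres Y h a) = f.appLE U' V (e.trans (preimage_mono f h)) a := by
  rw [show f.appLE U' V (e.trans (preimage_mono f h))
      = Y.presheaf.map (homOfLE h).op ≫ f.appLE U V e from (f.map_appLE e (homOfLE h).op).symm]
  rfl

/-- Pullback of global sections of a line bundle. -/
def pullbackSec (f : X ⟶ Y) (L : LineBundle Y) (σ : GlobalSec L) :
    GlobalSec (pullbackLB f L) where
  s i := f.app (L.U i) (σ.s i)
  compat i j := by
    have key := congrArg (f.appLE (L.U i ⊓ L.U j)
      (f ⁻¹ᵁ L.U i ⊓ f ⁻¹ᵁ L.U j) (preimage_inf f (L.U i) (L.U j)).ge) (σ.compat i j)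
    rw [map_mul, appLE_sres, appLE_sres] at key
    exact key

end LineBundle

attribute [local instance] MvPolynomial.gradedAlgebra

/-- Projective `N`-space over `k`, as the `Proj` of the polynomial ring in `N + 1`
variables with its standard grading. -/
def ProjSpace (k : Type u) [Field k] (N : ℕ) : Scheme.{u} :=
  Proj (MvPolynomial.homogeneousSubmodule (Fin (N + 1)) k)

/-- The inclusion of `k` into the degree-zero part of the polynomial ring. -/
def degreeZeroInclusion (k : Type u) [Field k] (N : ℕ) :
    k →+* (MvPolynomial.homogeneousSubmodule (Fin (N + 1)) k 0) where
  toFun c := ⟨MvPolynomial.C c, by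
    simp [MvPolynomial.mem_homogeneousSubmodule, MvPolynomial.isHomogeneous_C]⟩
  map_one' := by ext; simp
  map_mul' x y := by ext; simp
  map_zero' := by ext; simp
  map_add' x y := by ext; simp

/-- The structure morphism of projective space over `k`. -/
def ProjSpace.str (k : Type u) [Field k] (N : ℕ) :
    ProjSpace k N ⟶ Spec (CommRingCat.of k) :=
  Proj.toSpecZero _ ≫ Spec.map (CommRingCat.ofHom (degreeZeroInclusion k N))

/-- A scheme over `k` is a projective variety if it is integral and admits a closed
immersion into some projective space over `k`, compatibly with the structure morphisms. -/
def IsProjectiveVariety {k : Type u} [Field k] {X : Scheme.{u}}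
    (sX : X ⟶ Spec (CommRingCat.of k)) : Prop :=
  IsIntegral X ∧ ∃ (N : ℕ) (ι : X ⟶ ProjSpace k N),
    IsClosedImmersion ι ∧ ι ≫ ProjSpace.str k N = sX

open LineBundle in
/-- `O1` is (isomorphic to) the tautological very ample bundle `O(1)` on `ℙ^N_k`:
its powers have the section space dimensions of `O(n)` (which characterises `O(1)` in
`Pic(ℙ^N) ≅ ℤ`). -/
def IsTautologicalBundle (k : Type u) [Field k] (N : ℕ)
    (O1 : LineBundle (ProjSpace k N)) : Prop :=
  ∀ n : ℕ, h0 (ProjSpace.str k N) (O1.pow n) = Nat.choose (N + n) N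

namespace MvPolynomial

/-- The substitution `x_i ↦ x_i T`, whose coefficients are the homogeneous components. -/
def spread (σ : Type*) (k : Type*) [CommRing k] :
    MvPolynomial σ k →ₐ[k] Polynomial (MvPolynomial σ k) :=
  aeval fun i => Polynomial.C (X i) * Polynomial.X

lemma coeff_spread {σ k : Type*} [CommRing k] (f : MvPolynomial σ k) (n : ℕ) :
    (spread σ k f).coeff n = homogeneousComponent n f := by
  induction f using MvPolynomial.induction_on' generalizing n with
  | monomial s a =>
    have h : spread σ k (monomial s a) = Polynomial.monomial s.degree (monomial s a) := by
      rw [spread, aeval_monomial, Finsupp.prod]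
      simp only [mul_pow, Finset.prod_mul_distrib, Finset.prod_pow_eq_pow_sum]
      rw [← Polynomial.C_mul_X_pow_eq_monomial, monomial_eq, Finsupp.prod, map_mul, map_prod,
        mul_assoc]
      simp only [map_pow]
      rfl
    rw [h, Polynomial.coeff_monomial]
    split_ifs with hn
    · exact (homogeneousComponent_eq_self (isHomogeneous_monomial a hn)).symm
    · rw [homogeneousComponent_of_mem (isHomogeneous_monomial a rfl), if_neg]
      exact fun h => hn h.symm
  | add p q hp hq => simp [hp, hq]

lemma IsHomogeneous.exists_of_mul {σ k : Type*} [CommRing k] [IsDomain k]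
    {f g : MvPolynomial σ k} {n : ℕ} (h : (f * g).IsHomogeneous n) (h0 : f * g ≠ 0) :
    ∃ p q, f.IsHomogeneous p ∧ g.IsHomogeneous q ∧ p + q = n := by
  have inj : Function.Injective (spread σ k) := by
    refine (injective_iff_map_eq_zero _).2 fun p hp => ?_
    rw [← sum_homogeneousComponent p]
    exact Finset.sum_eq_zero fun i _ => by rw [← coeff_spread, hp, Polynomial.coeff_zero]
  have hmul : spread σ k f * spread σ k g = Polynomial.monomial n (f * g) := by
    rw [← map_mul]
    ext1 m
    rw [coeff_spread, Polynomial.coeff_monomial, homogeneousComponent_of_mem h]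
    simp only [eq_comm]
  have hf : spread σ k f ≠ 0 := by
    rw [Ne, map_eq_zero_iff _ inj]; exact left_ne_zero_of_mul h0
  have hg : spread σ k g ≠ 0 := by
    rw [Ne, map_eq_zero_iff _ inj]; exact right_ne_zero_of_mul h0
  have h1 := Polynomial.natDegree_mul hf hg
  have h2 := Polynomial.natTrailingDegree_mul hf hg
  rw [hmul, Polynomial.natDegree_monomial_eq _ h0] at h1
  rw [hmul, Polynomial.natTrailingDegree_monomial h0] at h2
  have h3 := Polynomial.natTrailingDegree_le_natDegree (spread σ k f)
  have h4 := Polynomial.natTrailingDegree_le_natDegree (spread σ k g)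
  have key : ∀ p : MvPolynomial σ k,
      (spread σ k p).natTrailingDegree = (spread σ k p).natDegree →
      p.IsHomogeneous (spread σ k p).natDegree := by
    intro p hp
    rw [← sum_homogeneousComponent p]
    refine IsHomogeneous.sum _ _ _ fun i _ => ?_
    rw [sum_homogeneousComponent p]
    by_cases hi : i = (spread σ k p).natDegree
    · rw [← hi]; exact homogeneousComponent_isHomogeneous i p
    · rw [← coeff_spread]
      rcases lt_or_gt_of_ne hi with hi | hi
      · rw [Polynomial.coeff_eq_zero_of_lt_natTrailingDegree (hp ▸ hi)]
        exact isHomogeneous_zero _ _ _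
      · rw [Polynomial.coeff_eq_zero_of_natDegree_lt hi]
        exact isHomogeneous_zero _ _ _
  exact ⟨_, _, key f (by omega), key g (by omega), h1.symm⟩

lemma IsHomogeneous.exists_of_dvd {σ k : Type*} [CommRing k] [IsDomain k]
    {f g : MvPolynomial σ k} {n : ℕ} (h : g.IsHomogeneous n) (h0 : g ≠ 0) (hd : f ∣ g) :
    ∃ p, f.IsHomogeneous p := by
  obtain ⟨r, rfl⟩ := hd
  obtain ⟨p, q, hp, -, -⟩ := h.exists_of_mul h0
  exact ⟨p, hp⟩

/-- Monomials witnessing that the space of forms of degree `m ≥ 2` in at least two variables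
has dimension larger than the number of variables. -/
lemma card_lt_finrank_homogeneousSubmodule {k : Type*} [Field k] {N m : ℕ} (hN : 1 ≤ N)
    (hm : 2 ≤ m) (hfin : Module.Finite k (homogeneousSubmodule (Fin (N + 1)) k m)) :
    N + 1 < Module.finrank k (homogeneousSubmodule (Fin (N + 1)) k m) := by
  let e : Option (Fin (N + 1)) → (Fin (N + 1) →₀ ℕ) := fun o =>
    o.elim (Finsupp.single 1 m) fun i => Finsupp.single 0 (m - 1) + Finsupp.single i 1
  have h10 : (1 : Fin (N + 1)) ≠ 0 := by
    intro h
    have := congrArg Fin.val h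
    rw [Fin.val_one', Fin.val_zero, Nat.mod_eq_of_lt (by omega)] at this
    omega
  have hnone : ∀ i, e none ≠ e (some i) := by
    intro i h
    have := DFunLike.congr_fun h 0
    simp only [e, Option.elim, Finsupp.add_apply, Finsupp.single_apply, if_neg h10] at this
    simp at this
    omega
  have he : Function.Injective e := by
    rintro (_ | i) (_ | j) h
    · rfl
    · exact (hnone _ h).elim
    · exact (hnone _ h.symm).elim
    · have := add_left_cancel h
      rw [Finsupp.single_left_inj one_ne_zero] at this
      rw [this]
  have hdeg : ∀ o, (e o).degree = m := by
    rintro (_ | i)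
    · simp [e]
    · simp only [e, Option.elim, map_add, Finsupp.degree_single]; omega
  let v : Option (Fin (N + 1)) → homogeneousSubmodule (Fin (N + 1)) k m := fun o =>
    ⟨monomial (e o) 1, isHomogeneous_monomial 1 (hdeg o)⟩
  have hv : LinearIndependent k v := by
    refine LinearIndependent.of_comp (homogeneousSubmodule (Fin (N + 1)) k m).subtype ?_
    exact (basisMonomials (Fin (N + 1)) k).linearIndependent.comp e he
  have := hv.fintype_card_le_finrank
  simpa using this

lemma finrank_homogeneousSubmodule_zero (k : Type*) [Field k] (σ : Type*) :
    Module.finrank k (homogeneousSubmodule σ k 0) = 1 := by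
  refine _root_.finrank_eq_one (⟨1, isHomogeneous_one σ k⟩ : homogeneousSubmodule σ k 0) ?_ ?_
  · exact fun h => one_ne_zero (congrArg Subtype.val h)
  · rintro ⟨w, hw⟩
    rw [homogeneousSubmodule_zero] at hw
    obtain ⟨c, rfl⟩ := Submodule.mem_one.1 hw
    exact ⟨c, Subtype.ext (by simp [Algebra.smul_def])⟩

end MvPolynomial

/-- Over an infinite field, an affine subspace `v + W` is not contained in a finite union of
linear subspaces none of which contains `W`. -/
lemma exists_add_notMem_of_finite {k E : Type*} [Field k] [Infinite k] [AddCommGroup E]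
    [Module k E] (W : Submodule k E) (v : E) {s : Set (Submodule k E)} (hs : s.Finite)
    (h : ∀ Q ∈ s, ¬ W ≤ Q) : ∃ w ∈ W, ∀ Q ∈ s, v + w ∉ Q := by
  classical
  let Φ : W × k →ₗ[k] E := W.subtype.coprod (LinearMap.toSpanSingleton k E v)
  have hΦ : ∀ x, Φ x = (x.1 : E) + x.2 • v := fun x => by simp [Φ]
  let t : Finset (Submodule k (W × k)) :=
    insert (LinearMap.ker (LinearMap.snd k W k)) (hs.toFinset.image fun Q => Q.comap Φ)
  have ht : ⊤ ∉ t := by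
    rw [Finset.mem_insert, not_or, Finset.mem_image]
    constructor
    · intro h0
      have : ((0, 1) : W × k) ∈ LinearMap.ker (LinearMap.snd k W k) := h0 ▸ Submodule.mem_top
      simp at this
    · rintro ⟨Q, hQ, hQt⟩
      refine h Q (hs.mem_toFinset.1 hQ) fun w hw => ?_
      have : ((⟨w, hw⟩, 0) : W × k) ∈ Q.comap Φ := hQt ▸ Submodule.mem_top
      rw [Submodule.mem_comap, hΦ] at this
      simpa using this
  have := Subspace.biUnion_ne_univ_of_top_notMem ht
  obtain ⟨⟨w, c⟩, hwc⟩ := (Set.ne_univ_iff_exists_notMem _).1 this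
  simp only [Set.mem_iUnion, not_exists] at hwc
  have hc : c ≠ 0 := by
    intro hc
    refine hwc _ (Finset.mem_insert_self _ _) ?_
    simp [hc]
  refine ⟨c⁻¹ • w, W.smul_mem _ w.2, fun Q hQ hmem => ?_⟩
  refine hwc (Q.comap Φ)
    (Finset.mem_insert_of_mem (Finset.mem_image_of_mem _ (hs.mem_toFinset.2 hQ))) ?_
  have := Q.smul_mem c hmem
  rw [smul_add, smul_smul, mul_inv_cancel₀ hc, one_smul] at this
  show Φ (w, c) ∈ Q
  rw [hΦ, add_comm]
  exact this

/-- Moving elements `F j` of a Noetherian `k`-algebra inside their classes modulo a subspace `W`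
so that, away from the zero locus of `W`, each of them drops the dimension. -/
lemma exists_add_height {k S : Type*} [Field k] [Infinite k] [CommRing S] [IsNoetherianRing S]
    [Algebra k S] (W : Submodule k S) (F : ℕ → S) (n : ℕ) :
    ∃ h : ℕ → S, (∀ j, h j ∈ W) ∧ ∀ Q : Ideal S, Q.IsPrime → (∀ j < n, F j + h j ∈ Q) →
      ¬ (W : Set S) ⊆ Q → (n : ℕ∞) ≤ Q.height := by
  induction n with
  | zero => exact ⟨0, fun _ => W.zero_mem, fun Q _ _ _ => by simp⟩
  | succ n ih =>
    obtain ⟨h, hW, hQ⟩ := ih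
    let J : Ideal S := Ideal.span {x | ∃ j < n, x = F j + h j}
    have hJ : ∀ Q : Ideal S, J ≤ Q ↔ ∀ j < n, F j + h j ∈ Q := by
      intro Q
      rw [Ideal.span_le]
      exact ⟨fun H j hj => H ⟨j, hj, rfl⟩, by rintro H _ ⟨j, hj, rfl⟩; exact H j hj⟩
    let s : Set (Submodule k S) :=
      (fun Q : Ideal S => Q.restrictScalars k) '' {Q ∈ J.minimalPrimes | ¬ (W : Set S) ⊆ Q}
    have hs : s.Finite :=
      ((J.finite_minimalPrimes_of_isNoetherianRing S).subset (Set.sep_subset _ _)).image _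
    obtain ⟨w, hw, hws⟩ := exists_add_notMem_of_finite W (F n) hs (by
      rintro _ ⟨Q, hQ, rfl⟩ hle
      exact hQ.2 fun x hx => hle hx)
    refine ⟨Function.update h n w, fun j => ?_, fun P hP hPF hPW => ?_⟩
    · rcases eq_or_ne j n with rfl | hj
      · simpa using hw
      · simpa [Function.update_of_ne hj] using hW j
    · have hPJ : J ≤ P := (hJ P).2 fun j hj => by
        have := hPF j (by omega)
        rwa [Function.update_of_ne (by omega)] at this
      obtain ⟨Q, hQmin, hQP⟩ := Ideal.exists_minimalPrimes_le hPJ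
      have hQp : Q.IsPrime := hQmin.1.1
      have hQW : ¬ (W : Set S) ⊆ Q := fun H => hPW fun x hx => hQP (H hx)
      have hlt : Q < P := by
        refine lt_of_le_of_ne hQP ?_
        rintro rfl
        have := hPF n (by omega)
        rw [Function.update_self] at this
        exact hws _ ⟨Q, ⟨hQmin, hQW⟩, rfl⟩ this
      have h1 := hQ Q hQp ((hJ Q).1 hQmin.1.2) hQW
      push_cast
      calc (n : ℕ∞) + 1 ≤ Q.height + 1 := by gcongr
        _ ≤ P.height := by
          rw [ENat.add_one_le_iff]
          · exact Ideal.height_strict_mono_of_isPrime_of_isPrime hlt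
          · exact (Ideal.height_lt_top hQp.ne_top).ne

open MvPolynomial in
lemma exists_add_forms {k : Type*} [Field k] [Infinite k] {N : ℕ}
    (W : Submodule k (MvPolynomial (Fin (N + 1)) k)) (F : Fin (N + 1) → MvPolynomial (Fin (N + 1)) k) :
    ∃ h : Fin (N + 1) → MvPolynomial (Fin (N + 1)) k, (∀ j, h j ∈ W) ∧
      ∀ Q : Ideal (MvPolynomial (Fin (N + 1)) k), Q.IsPrime → (∀ j, F j + h j ∈ Q) →
        Q < Ideal.span (Set.range X) →
        (W : Set (MvPolynomial (Fin (N + 1)) k)) ⊆ Q := by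
  obtain ⟨h, hW, hQ⟩ := exists_add_height W (fun j => F (Fin.ofNat (N + 1) j)) (N + 1)
  refine ⟨fun j => h j, fun j => hW j, fun Q hQp hQF hlt => ?_⟩
  by_contra hcon
  have h1 := hQ Q hQp (fun j hj => by
    have := hQF ⟨j, hj⟩
    have h2 : Fin.ofNat (N + 1) j = ⟨j, hj⟩ := Fin.ext (Nat.mod_eq_of_lt hj)
    simpa only [h2] using this) hcon
  have hm : Ideal.span (Set.range (X : Fin (N + 1) → MvPolynomial (Fin (N + 1)) k)) ≠ ⊤ := by
    intro h
    have : (1 : MvPolynomial (Fin (N + 1)) k) ∈ Ideal.span (Set.range X) := h ▸ Submodule.mem_top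
    have hle : Ideal.span (Set.range (X : Fin (N + 1) → MvPolynomial (Fin (N + 1)) k)) ≤
        RingHom.ker (constantCoeff (R := k) (σ := Fin (N + 1))) := by
      rw [Ideal.span_le]; rintro _ ⟨i, rfl⟩; simp
    simpa using hle this
  have h3 := Ideal.height_strict_mono_of_isPrime hlt
  have h2 := Ideal.height_le_ringKrullDim_of_ne_top hm
  rw [MvPolynomial.ringKrullDim_of_isNoetherianRing, ringKrullDim_eq_zero_of_field] at h2
  simp only [Nat.card_eq_fintype_card, Fintype.card_fin, zero_add] at h2
  have h2' : (Ideal.span (Set.range (X : Fin (N + 1) → MvPolynomial (Fin (N + 1)) k))).height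
      ≤ ((N + 1 : ℕ) : ℕ∞) := by exact_mod_cast h2
  exact absurd (h1.trans_lt (h3.trans_le h2')) (lt_irrefl _)

section FracDeg

open MvPolynomial

variable {k : Type u} [Field k] {N : ℕ}

/-- The homogeneous coordinate ring of projective space. -/
abbrev FormRing (k : Type u) [Field k] (N : ℕ) : Type u := MvPolynomial (Fin (N + 1)) k

/-- The points of projective space, as homogeneous primes. -/
abbrev FormSpec (k : Type u) [Field k] (N : ℕ) : Type u :=
  ProjectiveSpectrum (homogeneousSubmodule (Fin (N + 1)) k)

/-- The fraction field of the homogeneous coordinate ring of projective space. -/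
abbrev FormFrac (k : Type u) [Field k] (N : ℕ) : Type u := FractionRing (FormRing k N)

/-- `g` is a quotient of forms of degree `m` whose denominator does not vanish at `y`. -/
def RegDeg (y : FormSpec k N) (m : ℤ) (g : FormFrac k N) : Prop :=
  ∃ (p q : ℕ) (a b : FormRing k N), a.IsHomogeneous p ∧ b.IsHomogeneous q ∧ b ∉ y.asHomogeneousIdeal ∧
    (p : ℤ) = q + m ∧ g * algebraMap _ _ b = algebraMap _ _ a

/-- `g` is a quotient of forms of degree `m`, neither of which vanishes at `y`. -/
def UnitDeg (y : FormSpec k N) (m : ℤ) (g : FormFrac k N) : Prop :=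
  ∃ (p q : ℕ) (a b : FormRing k N), a.IsHomogeneous p ∧ b.IsHomogeneous q ∧ a ∉ y.asHomogeneousIdeal ∧
    b ∉ y.asHomogeneousIdeal ∧ (p : ℤ) = q + m ∧ g * algebraMap _ _ b = algebraMap _ _ a

namespace ProjectiveSpectrum

lemma mul_notMem {y : FormSpec k N} {a b : FormRing k N} (ha : a ∉ y.asHomogeneousIdeal)
    (hb : b ∉ y.asHomogeneousIdeal) : a * b ∉ y.asHomogeneousIdeal :=
  fun h => (y.isPrime.mem_or_mem h).elim ha hb

lemma ne_zero_of_notMem {y : FormSpec k N} {a : FormRing k N} (ha : a ∉ y.asHomogeneousIdeal) : a ≠ 0 :=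
  fun h => ha (h ▸ y.asHomogeneousIdeal.toIdeal.zero_mem)

lemma one_notMem (y : FormSpec k N) : (1 : FormRing k N) ∉ y.asHomogeneousIdeal :=
  fun h => y.isPrime.ne_top ((Ideal.eq_top_iff_one _).2 h)

end ProjectiveSpectrum

open ProjectiveSpectrum

variable {y : FormSpec k N} {m n : ℤ} {g g' : FormFrac k N}

lemma algebraMap_frac_ne_zero {a : FormRing k N} (h : a ≠ 0) :
    algebraMap (FormRing k N) (FormFrac k N) a ≠ 0 := by
  rwa [Ne, map_eq_zero_iff _ (IsFractionRing.injective _ _)]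

lemma UnitDeg.regDeg (h : UnitDeg y m g) : RegDeg y m g := by
  obtain ⟨p, q, a, b, ha, hb, hay, hby, hpq, e⟩ := h
  exact ⟨p, q, a, b, ha, hb, hby, hpq, e⟩

lemma UnitDeg.ne_zero (h : UnitDeg y m g) : g ≠ 0 := by
  rintro rfl
  obtain ⟨p, q, a, b, ha, hb, hay, hby, hpq, e⟩ := h
  rw [zero_mul] at e
  exact algebraMap_frac_ne_zero (ne_zero_of_notMem hay) e.symm

lemma RegDeg.mul (h : RegDeg y m g) (h' : RegDeg y n g') : RegDeg y (m + n) (g * g') := by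
  obtain ⟨p, q, a, b, ha, hb, hby, hpq, e⟩ := h
  obtain ⟨p', q', a', b', ha', hb', hby', hpq', e'⟩ := h'
  refine ⟨_, _, _, _, ha.mul ha', hb.mul hb', mul_notMem hby hby', ?_, ?_⟩
  · push_cast; omega
  · rw [map_mul, map_mul, ← e, ← e']; ring

lemma UnitDeg.mul (h : UnitDeg y m g) (h' : UnitDeg y n g') : UnitDeg y (m + n) (g * g') := by
  obtain ⟨p, q, a, b, ha, hb, hay, hby, hpq, e⟩ := h
  obtain ⟨p', q', a', b', ha', hb', hay', hby', hpq', e'⟩ := h'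
  refine ⟨_, _, _, _, ha.mul ha', hb.mul hb', mul_notMem hay hay', mul_notMem hby hby', ?_, ?_⟩
  · push_cast; omega
  · rw [map_mul, map_mul, ← e, ← e']; ring

lemma UnitDeg.inv (h : UnitDeg y m g) : UnitDeg y (-m) g⁻¹ := by
  have h0 := h.ne_zero
  obtain ⟨p, q, a, b, ha, hb, hay, hby, hpq, e⟩ := h
  refine ⟨q, p, b, a, hb, ha, hby, hay, by omega, ?_⟩
  rw [← e, inv_mul_cancel_left₀ h0]

lemma UnitDeg.one (y : FormSpec k N) : UnitDeg y 0 1 :=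
  ⟨0, 0, 1, 1, isHomogeneous_one _ _, isHomogeneous_one _ _, one_notMem y, one_notMem y,
    by simp, by simp⟩

lemma UnitDeg.pow (h : UnitDeg y m g) (r : ℕ) : UnitDeg y (r * m) (g ^ r) := by
  induction r with
  | zero => simpa using UnitDeg.one y
  | succ r ih =>
    rw [pow_succ, Nat.cast_succ, add_mul, one_mul]
    exact ih.mul h

lemma RegDeg.of_isHomogeneous {F : FormRing k N} {r : ℕ} (hF : F.IsHomogeneous r) (y : FormSpec k N) :
    RegDeg y r (algebraMap _ _ F) :=
  ⟨r, 0, F, 1, hF, isHomogeneous_one _ _, one_notMem y, by simp, by simp⟩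

lemma UnitDeg.of_isHomogeneous {F : FormRing k N} {r : ℕ} (hF : F.IsHomogeneous r)
    (hy : F ∉ y.asHomogeneousIdeal) : UnitDeg y r (algebraMap _ _ F) :=
  ⟨r, 0, F, 1, hF, isHomogeneous_one _ _, hy, one_notMem y, by simp, by simp⟩

/-- A quotient of forms that is regular and a unit at `y` has no numerator vanishing at `y`. -/
lemma UnitDeg.notMem {F : FormRing k N} (h : UnitDeg y m (algebraMap _ _ F)) : F ∉ y.asHomogeneousIdeal := by
  obtain ⟨p, q, a, b, ha, hb, hay, hby, hpq, e⟩ := h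
  rw [← map_mul] at e
  have := IsFractionRing.injective (FormRing k N) (FormFrac k N) e
  intro hFy
  exact hay (this ▸ y.asHomogeneousIdeal.toIdeal.mul_mem_right _ hFy)

/-- The point of projective space that is generic in the hypersurface of a prime form lying in
some other point. -/
def primePoint (π : FormRing k N) (hπ : Prime π) {r : ℕ} (hr : π.IsHomogeneous r)
    (hirr : ¬ HomogeneousIdeal.irrelevant (homogeneousSubmodule (Fin (N + 1)) k) ≤
      (⟨Ideal.span {π}, Ideal.homogeneous_span _ _ (by
        rintro _ rfl; exact ⟨r, hr⟩)⟩ : HomogeneousIdeal _)) : FormSpec k N :=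
  ⟨⟨Ideal.span {π}, Ideal.homogeneous_span _ _ (by
        rintro _ rfl; exact ⟨r, hr⟩)⟩, (Ideal.span_singleton_prime hπ.ne_zero).2 hπ, hirr⟩

lemma mem_primePoint {π : FormRing k N} {hπ : Prime π} {r : ℕ} {hr : π.IsHomogeneous r} {hirr}
    {f : FormRing k N} : f ∈ (primePoint π hπ hr hirr).asHomogeneousIdeal ↔ π ∣ f :=
  Ideal.mem_span_singleton

lemma exists_primePoint {π : FormRing k N} (hπ : Prime π) {r : ℕ} (hr : π.IsHomogeneous r)
    (hy : π ∈ y.asHomogeneousIdeal) :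
    ∃ z : FormSpec k N, (∀ f, f ∈ z.asHomogeneousIdeal ↔ π ∣ f) ∧
      z.asHomogeneousIdeal ≤ y.asHomogeneousIdeal := by
  have hle : (⟨Ideal.span {π}, Ideal.homogeneous_span _ _ (by
        rintro _ rfl; exact ⟨r, hr⟩)⟩ : HomogeneousIdeal (homogeneousSubmodule (Fin (N + 1)) k)) ≤
        y.asHomogeneousIdeal :=
    (Ideal.span_singleton_le_iff_mem _).2 hy
  exact ⟨primePoint π hπ hr fun h => y.not_irrelevant_le (h.trans hle), fun f => mem_primePoint,
    hle⟩

lemma exists_prime_dvd_mem {q : FormRing k N} {n : ℕ} (hq : q.IsHomogeneous n) (h0 : q ≠ 0)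
    (hy : q ∈ y.asHomogeneousIdeal) :
    ∃ (π : FormRing k N) (r : ℕ), Prime π ∧ π.IsHomogeneous r ∧ π ∣ q ∧ π ∈ y.asHomogeneousIdeal := by
  obtain ⟨f, hf, hfq⟩ := UniqueFactorizationMonoid.exists_prime_factors q h0
  have hmem : f.prod ∈ y.asHomogeneousIdeal.toIdeal := by
    obtain ⟨c, hc⟩ := hfq.symm
    rw [← hc]
    exact Ideal.mul_mem_right _ _ hy
  obtain ⟨π, hπf, hπ⟩ := (Ideal.IsPrime.multiset_prod_mem_iff_exists_mem y.isPrime f).1 hmem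
  have hd : π ∣ q := (Multiset.dvd_prod hπf).trans hfq.dvd
  obtain ⟨r, hr⟩ := hq.exists_of_dvd h0 hd
  exact ⟨π, r, hf π hπf, hr, hd, hπ⟩

/-- Effective Cartier divisors on projective space, given locally by quotients of the forms
`D i` by a common form, are cut out by a global form. -/
lemma exists_cartier {J : Type*} (U : J → Set (FormSpec k N))
    (hU : ∀ i (y z : FormSpec k N), z.asHomogeneousIdeal ≤ y.asHomogeneousIdeal → y ∈ U i → z ∈ U i)
    (D : J → FormRing k N) (hD0 : ∀ i, D i ≠ 0)
    (hD : ∀ i j, ∀ y ∈ U i, y ∈ U j → ∃ r s : FormRing k N, r ∉ y.asHomogeneousIdeal ∧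
      s ∉ y.asHomogeneousIdeal ∧ D i * s = D j * r)
    (α : ℕ) (A : FormRing k N) (hA : A.IsHomogeneous α) (hA0 : A ≠ 0)
    (hsec : ∀ i, ∀ y ∈ U i, ∃ (p r : ℕ) (q b : FormRing k N), q.IsHomogeneous p ∧ b.IsHomogeneous r ∧
      b ∉ y.asHomogeneousIdeal ∧ D i * q = A * b) :
    ∃ (α : ℕ) (A : FormRing k N), A.IsHomogeneous α ∧ A ≠ 0 ∧
      ∀ i, ∀ y ∈ U i, ∃ (p r : ℕ) (q b : FormRing k N), q.IsHomogeneous p ∧ b.IsHomogeneous r ∧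
        q ∉ y.asHomogeneousIdeal ∧ b ∉ y.asHomogeneousIdeal ∧ D i * q = A * b := by
  induction α using Nat.strong_induction_on generalizing A with
  | _ α ih =>
  by_cases hall : ∀ i, ∀ y ∈ U i, ∃ (p r : ℕ) (q b : FormRing k N), q.IsHomogeneous p ∧
      b.IsHomogeneous r ∧ q ∉ y.asHomogeneousIdeal ∧ b ∉ y.asHomogeneousIdeal ∧ D i * q = A * b
  · exact ⟨α, A, hA, hA0, hall⟩
  push Not at hall
  obtain ⟨i₀, y, hy, hno⟩ := hall
  obtain ⟨p, r, q, b, hq, hb, hby, e⟩ := hsec i₀ y hy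
  have hqy : q ∈ y.asHomogeneousIdeal := by
    by_contra h
    exact hno p r q b hq hb h hby e
  have hb0 := ne_zero_of_notMem hby
  have hq0 : q ≠ 0 := by
    rintro rfl
    rw [mul_zero] at e
    exact mul_ne_zero hA0 hb0 e.symm
  obtain ⟨π, ρ, hπ, hπr, hπq, hπy⟩ := exists_prime_dvd_mem hq hq0 hqy
  have hπb : ¬ π ∣ b := fun h => hby (Ideal.mem_of_dvd _ h hπy)
  have hπA : π ∣ A := (hπ.dvd_or_dvd (e ▸ hπq.mul_left (D i₀))).resolve_right hπb
  obtain ⟨A', rfl⟩ := hπA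
  obtain ⟨ρ', α', hρ', hα', hsum⟩ := hA.exists_of_mul hA0
  have hρ : ρ' ≠ 0 := by
    rintro rfl
    rw [← mem_homogeneousSubmodule, homogeneousSubmodule_zero] at hρ'
    obtain ⟨c, rfl⟩ := Submodule.mem_one.1 hρ'
    exact hπ.not_isUnit (((isUnit_iff_ne_zero.2 fun h => hπ.ne_zero (by simp [h])) :
      IsUnit c).map (algebraMap k (FormRing k N)))
  obtain ⟨z, hz, hzy⟩ := exists_primePoint hπ hπr hπy
  refine ih α' (by omega) A' hα' (right_ne_zero_of_mul hA0) fun i y' hy' => ?_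
  obtain ⟨p', r', q', b', hq', hb', hby', e'⟩ := hsec i y' hy'
  by_cases hπy' : π ∈ y'.asHomogeneousIdeal
  · obtain ⟨z', hz', hzy'⟩ := exists_primePoint hπ hπr hπy'
    have hzz : z = z' := ProjectiveSpectrum.ext (HomogeneousIdeal.ext (by
      ext f; exact (hz f).trans (hz' f).symm))
    obtain ⟨u, s, hu, hs, e''⟩ := hD i i₀ z (hU i y' z (hzz ▸ hzy') hy') (hU i₀ y z hzy hy)
    rw [hz] at hu hs
    have key : u * b * q' = s * b' * q := by
      refine mul_left_cancel₀ (hD0 i₀) ?_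
      linear_combination s * e' * b - e'' * (q' * b) - s * b' * e
    have hπq' : π ∣ q' :=
      (hπ.dvd_or_dvd (key ▸ hπq.mul_left (s * b'))).resolve_left
        fun h => (hπ.dvd_or_dvd h).elim hu hπb
    obtain ⟨q'', rfl⟩ := hπq'
    have hb'0 := ne_zero_of_notMem hby'
    have hq'0 : π * q'' ≠ 0 := by
      intro h
      rw [h, mul_zero] at e'
      exact mul_ne_zero hA0 hb'0 e'.symm
    obtain ⟨_, p'', _, hp'', _⟩ := hq'.exists_of_mul hq'0
    exact ⟨p'', r', q'', b', hp'', hb', hby', mul_left_cancel₀ hπ.ne_zero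
      (by linear_combination e')⟩
  · exact ⟨p', _, q', π * b', hq', hπr.mul hb', mul_notMem hπy' hby', by rw [e']; ring⟩

end FracDeg

section FracDegFrame

open MvPolynomial ProjectiveSpectrum

variable {k : Type u} [Field k] {N : ℕ}

/-- Every line bundle on projective space is `O(m)` for some `m`, at the level of rational
functions: a system `f i` of rational functions whose quotients are units on overlaps agrees up to
units with a single quotient of forms. -/
lemma exists_unitDeg_mul {I : Type*} (U : I → Set (FormSpec k N))
    (hU : ∀ i (y z : FormSpec k N),
      z.asHomogeneousIdeal ≤ y.asHomogeneousIdeal → y ∈ U i → z ∈ U i)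
    (J : Finset I) (hJ : ∀ y, ∃ j ∈ J, y ∈ U j) (f : I → FormFrac k N)
    (hf : ∀ i, ∃ (p : ℕ) (a b : FormRing k N), a.IsHomogeneous p ∧ b.IsHomogeneous p ∧ a ≠ 0 ∧
      b ≠ 0 ∧ f i * algebraMap _ _ b = algebraMap _ _ a)
    (hov : ∀ i j, ∀ y ∈ U i, y ∈ U j → UnitDeg y 0 (f i / f j)) :
    ∃ (g : FormFrac k N) (m : ℤ), ∀ i, ∀ y ∈ U i, UnitDeg y m (f i * g) := by
  classical
  choose p a b ha hb ha0 hb0 hab using hf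
  have inj := IsFractionRing.injective (FormRing k N) (FormFrac k N)
  have hf0 : ∀ i, f i ≠ 0 := by
    intro i h
    have := hab i
    rw [h, zero_mul] at this
    exact algebraMap_frac_ne_zero (ha0 i) this.symm
  let C : FormRing k N := ∏ j ∈ J, a j
  let D : J → FormRing k N := fun i => b i * ∏ j ∈ J.erase i, a j
  let e : ℕ := ∑ j ∈ J, p j
  have hC0 : C ≠ 0 := Finset.prod_ne_zero_iff.2 fun j _ => ha0 j
  have hD0 : ∀ i, D i ≠ 0 := fun i =>
    mul_ne_zero (hb0 i) (Finset.prod_ne_zero_iff.2 fun j _ => ha0 j)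
  have hDe : ∀ i, (D i).IsHomogeneous e := by
    intro i
    have : e = p i + ∑ j ∈ J.erase i, p j := (Finset.add_sum_erase J p i.2).symm
    rw [this]
    exact (hb i).mul (IsHomogeneous.prod _ _ _ fun j _ => ha j)
  have hfD : ∀ i : J, f i * algebraMap _ _ (D i) = algebraMap _ _ C := by
    intro i
    have : C = a i * ∏ j ∈ J.erase i, a j := (Finset.mul_prod_erase J a i.2).symm
    rw [this, map_mul, map_mul, ← mul_assoc, hab]
  have hC0' := algebraMap_frac_ne_zero hC0
  have hD0' := fun i => algebraMap_frac_ne_zero (hD0 i)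
  clear_value D C e
  obtain ⟨α, A, hA, hA0, hAU⟩ := exists_cartier (fun i : J => U i) (fun i => hU i) D hD0
    (by
      intro i j y hi hj
      obtain ⟨p', q', a', b', -, -, hay, hby, -, e'⟩ := hov i j y hi hj
      refine ⟨b', a', hby, hay, inj ?_⟩
      rw [map_mul (algebraMap _ _) (D i), map_mul (algebraMap _ _) (D j), ← e']
      have h1 := hfD i
      rw [← hfD j] at h1
      have := hf0 j
      field_simp
      linear_combination (algebraMap _ _ b') * h1)
    _ (∏ j, D j) (IsHomogeneous.prod _ _ _ fun j _ => hDe j)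
    (Finset.prod_ne_zero_iff.2 fun j _ => hD0 j)
    (by
      intro i y hy
      refine ⟨_, 0, ∏ j ∈ Finset.univ.erase i, D j, 1, IsHomogeneous.prod _ _ _ fun j _ => hDe j,
        isHomogeneous_one _ _, one_notMem y, ?_⟩
      rw [mul_one, Finset.mul_prod_erase _ _ (Finset.mem_univ i)])
  have hmain : ∀ i : J, ∀ y ∈ U i, UnitDeg y ((α : ℤ) - e)
      (f i * (algebraMap _ _ A / algebraMap _ _ C)) := by
    intro i y hy
    obtain ⟨p', r', q, b', hq, hb', hqy, hby, e'⟩ := hAU i y hy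
    refine ⟨p', r', q, b', hq, hb', hqy, hby, ?_, ?_⟩
    · have h1 := (hDe i).mul hq
      rw [e'] at h1
      have := h1.inj_right (hA.mul hb') (mul_ne_zero hA0 (ne_zero_of_notMem hby))
      omega
    · have h1 := congrArg (algebraMap _ (FormFrac k N)) e'
      rw [map_mul, map_mul] at h1
      have h2 := hfD i
      have := hf0 i
      rw [← h2]
      have := hD0' i
      field_simp
      linear_combination -h1
  refine ⟨algebraMap _ _ A / algebraMap _ _ C, (α : ℤ) - e, fun i y hy => ?_⟩
  · obtain ⟨j, hj, hyj⟩ := hJ y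
    have h1 := (hov i j y hy hyj).mul (hmain ⟨j, hj⟩ y hyj)
    have := hf0 j
    rw [zero_add] at h1
    convert h1 using 1
    field_simp

/-- A rational function on affine space that is everywhere a quotient of forms of degree `m` is
a form of degree `m`. -/
lemma exists_isHomogeneous_of_regDeg (hN : 1 ≤ N) {m : ℤ} {g : FormFrac k N}
    (h : ∀ y : FormSpec k N, RegDeg y m g) (y₀ : FormSpec k N) :
    g = 0 ∨ ∃ (n : ℕ) (F : FormRing k N), (n : ℤ) = m ∧ F.IsHomogeneous n ∧
      g = algebraMap _ _ F := by
  by_cases hg0 : g = 0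
  · exact Or.inl hg0
  right
  have inj := IsFractionRing.injective (FormRing k N) (FormFrac k N)
  let P := IsFractionRing.num (FormRing k N) g
  let Q : FormRing k N := IsFractionRing.den (FormRing k N) g
  have hPQ : IsRelPrime P Q := IsFractionRing.num_den_reduced (FormRing k N) g
  have hQ0 : Q ≠ 0 := nonZeroDivisors.ne_zero (IsFractionRing.den (FormRing k N) g).2
  have hgQ : g * algebraMap _ _ Q = algebraMap _ _ P := by
    rw [IsFractionRing.num_mul_den_eq_num_iff_eq]
  have hdiv : ∀ (b a : FormRing k N), g * algebraMap _ _ b = algebraMap _ _ a → Q ∣ b := by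
    intro b a hab
    have : P * b = a * Q := inj (by rw [map_mul, map_mul, ← hgQ, ← hab]; ring)
    exact hPQ.symm.dvd_of_dvd_mul_left ⟨a, by rw [this, mul_comm]⟩
  have hQu : IsUnit Q := by
    by_contra hQu
    obtain ⟨p, q, a, b, ha, hb, hby, hpq, e⟩ := h y₀
    obtain ⟨f, hf, hfq⟩ := UniqueFactorizationMonoid.exists_prime_factors Q hQ0
    have hex : ∃ π ∈ f, Prime π := by
      rcases Multiset.empty_or_exists_mem f with rfl | ⟨π, hπ⟩
      · exact (hQu (hfq.isUnit (by simp))).elim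
      · exact ⟨π, hπ, hf π hπ⟩
    obtain ⟨π, hπf, hπ⟩ := hex
    have hπQ : π ∣ Q := (Multiset.dvd_prod hπf).trans hfq.dvd
    obtain ⟨r, hr⟩ := hb.exists_of_dvd (ne_zero_of_notMem hby) (hπQ.trans (hdiv b a e))
    have h10 : (1 : Fin (N + 1)) ≠ 0 := by
      intro h
      have := congrArg Fin.val h
      rw [Fin.val_one', Fin.val_zero, Nat.mod_eq_of_lt (by omega)] at this
      omega
    let z : FormSpec k N := primePoint π hπ hr (by
      intro hle
      have hX : ∀ i : Fin (N + 1), π ∣ X i := fun i =>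
        Ideal.mem_span_singleton.1 (hle (HomogeneousIdeal.mem_irrelevant_of_mem _ one_pos
          (isHomogeneous_X k i)))
      obtain ⟨c, hc⟩ := hX 0
      have hirr : Irreducible (X 0 : FormRing k N) := (MvPolynomial.X_prime (i := 0)).irreducible
      have hcu := (hirr.isUnit_or_isUnit hc).resolve_left hπ.not_isUnit
      have : (X 0 : FormRing k N) ∣ X 1 := by
        obtain ⟨v, rfl⟩ := hcu
        rw [hc]
        exact (Units.mul_right_dvd).2 (hX 1)
      rw [MvPolynomial.X_dvd_X] at this
      exact h10 this.symm)
    obtain ⟨p', q', a', b', ha', hb', hby', hpq', e'⟩ := h z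
    exact hby' (mem_primePoint.2 (hπQ.trans (hdiv b' a' e')))
  obtain ⟨v, hv⟩ := hQu
  have hgF : g = algebraMap _ _ (P * ↑v⁻¹) := by
    rw [map_mul, ← hgQ, ← hv, mul_assoc, ← map_mul, Units.mul_inv, map_one, mul_one]
  obtain ⟨p, q, a, b, ha, hb, hby, hpq, e⟩ := h y₀
  rw [hgF, ← map_mul] at e
  have e := inj e
  have hF0 : P * ↑v⁻¹ ≠ 0 := by
    intro h; rw [h, map_zero] at hgF; exact hg0 hgF
  have hb0 := ne_zero_of_notMem hby
  rw [← e] at ha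
  obtain ⟨n, q', hn, hq', hsum⟩ := ha.exists_of_mul (mul_ne_zero hF0 hb0)
  have := hq'.inj_right hb hb0
  exact ⟨n, _, by omega, hn, hgF⟩

end FracDegFrame

namespace ProjSpace

open MvPolynomial ProjectiveSpectrum LineBundle

variable {k : Type u} [Field k] {N : ℕ}

/-- The value at a point of a section of the structure sheaf, as a rational function. -/
def fracVal (x : FormSpec k N) :
    HomogeneousLocalization.AtPrime (homogeneousSubmodule (Fin (N + 1)) k)
      x.asHomogeneousIdeal.toIdeal →+* FormFrac k N :=
  (IsLocalization.lift (M := x.asHomogeneousIdeal.toIdeal.primeCompl)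
    (S := Localization.AtPrime x.asHomogeneousIdeal.toIdeal)
    (g := algebraMap (FormRing k N) (FormFrac k N))
    (fun y => isUnit_iff_ne_zero.2 (algebraMap_frac_ne_zero
      (ProjectiveSpectrum.ne_zero_of_notMem (y := x) y.2)))).comp
  (algebraMap _ (Localization.AtPrime x.asHomogeneousIdeal.toIdeal))

lemma fracVal_mk_mul (x : FormSpec k N)
    (c : HomogeneousLocalization.NumDenSameDeg (homogeneousSubmodule (Fin (N + 1)) k)
      x.asHomogeneousIdeal.toIdeal.primeCompl) :
    fracVal x (HomogeneousLocalization.mk c) * algebraMap _ _ (c.den : FormRing k N) =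
      algebraMap _ _ (c.num : FormRing k N) := by
  have h := IsLocalization.mk'_spec (Localization.AtPrime x.asHomogeneousIdeal.toIdeal)
    (c.num : FormRing k N) ⟨c.den, c.den_mem⟩
  rw [fracVal, RingHom.comp_apply, HomogeneousLocalization.algebraMap_apply,
    HomogeneousLocalization.val_mk, Localization.mk_eq_mk']
  have h' := congrArg (IsLocalization.lift (M := x.asHomogeneousIdeal.toIdeal.primeCompl)
    (S := Localization.AtPrime x.asHomogeneousIdeal.toIdeal)
    (g := algebraMap (FormRing k N) (FormFrac k N))
    (fun y => isUnit_iff_ne_zero.2 (algebraMap_frac_ne_zero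
      (ProjectiveSpectrum.ne_zero_of_notMem (y := x) y.2)))) h
  rwa [map_mul, IsLocalization.lift_eq, IsLocalization.lift_eq] at h'

lemma fracVal_injective (x : FormSpec k N) : Function.Injective (fracVal x) := by
  rw [injective_iff_map_eq_zero]
  intro a ha
  obtain ⟨c, rfl⟩ := HomogeneousLocalization.mk_surjective a
  have h := fracVal_mk_mul x c
  rw [ha, zero_mul] at h
  have h0 : (c.num : FormRing k N) = 0 := by
    by_contra h0
    exact algebraMap_frac_ne_zero h0 h.symm
  apply HomogeneousLocalization.val_injective
  rw [HomogeneousLocalization.val_mk, HomogeneousLocalization.val_zero, h0, Localization.mk_zero]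

lemma fracVal_regDeg (x : FormSpec k N) (a) : RegDeg x 0 (fracVal x a) := by
  obtain ⟨c, rfl⟩ := HomogeneousLocalization.mk_surjective a
  exact ⟨c.deg, c.deg, c.num, c.den, c.num.2, c.den.2, c.den_mem, by simp, fracVal_mk_mul x c⟩

variable (k N) in
/-- The generic point of projective space. -/
def genPt : FormSpec k N :=
  ⟨⊥, Ideal.isPrime_bot, fun h => MvPolynomial.X_ne_zero (R := k) (0 : Fin (N + 1))
    (h (HomogeneousIdeal.mem_irrelevant_of_mem _ one_pos (isHomogeneous_X k 0)))⟩

lemma notMem_genPt {a : FormRing k N} (h : a ≠ 0) : a ∉ (genPt k N).asHomogeneousIdeal := h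

lemma genPt_le (x : FormSpec k N) : genPt k N ≤ x := by
  intro a ha
  rw [show a = 0 from ha]
  exact Ideal.zero_mem _

lemma mem_of_le (U : (ProjSpace k N).Opens) {z y : FormSpec k N}
    (h : z.asHomogeneousIdeal ≤ y.asHomogeneousIdeal) (hy : y ∈ U) : z ∈ U := by
  have : y ∈ closure {z} := (ProjectiveSpectrum.le_iff_mem_closure (homogeneousSubmodule (Fin (N + 1)) k) z y).1 h
  obtain ⟨w, hw, hwz⟩ := mem_closure_iff.1 this U.1 U.2 hy
  rwa [← Set.mem_singleton_iff.1 hwz]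

lemma genPt_mem {U : (ProjSpace k N).Opens} {x : FormSpec k N} (hx : x ∈ U) : genPt k N ∈ U :=
  mem_of_le U (genPt_le x) hx

/-- The value of a section of the structure sheaf at a point, as a rational function. -/
def valAt (U : (ProjSpace k N).Opens) (x : FormSpec k N) (hx : x ∈ U) :
    Γ(ProjSpace k N, U) →+* FormFrac k N :=
  (fracVal x).comp (openToLocalization (homogeneousSubmodule (Fin (N + 1)) k) U x hx).hom

/-- The rational function defined by a section of the structure sheaf over a nonempty open. -/
def ev (U : (ProjSpace k N).Opens) (h : genPt k N ∈ U) :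
    Γ(ProjSpace k N, U) →+* FormFrac k N := valAt U (genPt k N) h

lemma exists_frac (U : (ProjSpace k N).Opens) (x : FormSpec k N) (hx : x ∈ U)
    (s : Γ(ProjSpace k N, U)) : ∃ (V : (ProjSpace k N).Opens) (_ : x ∈ V) (hVU : V ≤ U)
      (n : ℕ) (r b : FormRing k N), r.IsHomogeneous n ∧ b.IsHomogeneous n ∧
      ∀ y (hy : y ∈ V), b ∉ y.asHomogeneousIdeal ∧
        valAt U y (hVU hy) s * algebraMap _ _ b = algebraMap _ _ r := by
  obtain ⟨V, hxV, i, n, ⟨r, hr⟩, ⟨b, hb⟩, nin, h⟩ := s.2 ⟨x, hx⟩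
  refine ⟨V, hxV, i.le, n, r, b, hr, hb, fun y hy => ⟨nin ⟨y, hy⟩, ?_⟩⟩
  have := congrArg (fracVal y) (h ⟨y, hy⟩)
  have h2 := fracVal_mk_mul y ⟨n, ⟨r, hr⟩, ⟨b, hb⟩, nin ⟨y, hy⟩⟩
  exact (congrArg (· * algebraMap _ _ b) this).trans h2

lemma valAt_eq_ev {U : (ProjSpace k N).Opens} (x : FormSpec k N) (hx : x ∈ U)
    (s : Γ(ProjSpace k N, U)) : valAt U x hx s = ev U (genPt_mem hx) s := by
  obtain ⟨V, hxV, hVU, n, r, b, hr, hb, h⟩ := exists_frac U x hx s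
  have h1 := h x hxV
  have h2 := h _ (genPt_mem hxV)
  have := algebraMap_frac_ne_zero (ne_zero_of_notMem h1.1)
  exact mul_right_cancel₀ this (h1.2.trans h2.2.symm)

lemma ev_sres {U V : (ProjSpace k N).Opens} (hVU : V ≤ U) (h : genPt k N ∈ V)
    (s : Γ(ProjSpace k N, U)) : ev V h (sres _ hVU s) = ev U (hVU h) s := rfl

lemma ev_injective (U : (ProjSpace k N).Opens) (h : genPt k N ∈ U) :
    Function.Injective (ev U h) := by
  intro s t hst
  apply Proj.ext
  funext ⟨x, hx⟩
  apply fracVal_injective x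
  exact (valAt_eq_ev x hx s).trans (hst.trans (valAt_eq_ev x hx t).symm)

lemma regDeg_ev {U : (ProjSpace k N).Opens} {x : FormSpec k N} (hx : x ∈ U)
    (s : Γ(ProjSpace k N, U)) : RegDeg x 0 (ev U (genPt_mem hx) s) := by
  rw [← valAt_eq_ev x hx]
  exact fracVal_regDeg x _

lemma exists_ev_eq (U : (ProjSpace k N).Opens) (hU : genPt k N ∈ U) (g : FormFrac k N)
    (h : ∀ x ∈ U, RegDeg x 0 g) : ∃ s : Γ(ProjSpace k N, U), ev U hU s = g := by
  choose! p q a b ha hb hbx hpq e using h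
  have hpq' : ∀ x ∈ U, q x = p x := fun x hx => by have := hpq x hx; omega
  have hb' : ∀ x ∈ U, (b x).IsHomogeneous (p x) := fun x hx => hpq' x hx ▸ hb x hx
  let s : ∀ x : {x : FormSpec k N // x ∈ U}, HomogeneousLocalization.AtPrime (homogeneousSubmodule (Fin (N + 1)) k)
      x.1.asHomogeneousIdeal.toIdeal := fun x =>
    HomogeneousLocalization.mk ⟨p x.1, ⟨a x.1, ha x.1 x.2⟩, ⟨b x.1, hb' x.1 x.2⟩, hbx x.1 x.2⟩
  have hs : ∀ x : {x : FormSpec k N // x ∈ U}, fracVal x.1 (s x) = g := by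
    intro x
    have h1 := fracVal_mk_mul x.1 ⟨p x.1, ⟨a x.1, ha x.1 x.2⟩, ⟨b x.1, hb' x.1 x.2⟩, hbx x.1 x.2⟩
    have h2 := e x.1 x.2
    exact mul_right_cancel₀ (algebraMap_frac_ne_zero (ne_zero_of_notMem (hbx x.1 x.2)))
      (h1.trans h2.symm)
  have hloc : (ProjectiveSpectrum.StructureSheaf.isLocallyFraction
      (homogeneousSubmodule (Fin (N + 1)) k)).pred (U := U) s := by
    intro x
    let V : (ProjSpace k N).Opens := U ⊓ Proj.basicOpen _ (b x.1)
    refine ⟨V, ⟨x.2, hbx x.1 x.2⟩, homOfLE inf_le_left, p x.1, ⟨a x.1, ha x.1 x.2⟩,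
      ⟨b x.1, hb' x.1 x.2⟩, fun y => y.2.2, fun y => ?_⟩
    apply fracVal_injective y.1
    have h1 := fracVal_mk_mul y.1 ⟨p x.1, ⟨a x.1, ha x.1 x.2⟩, ⟨b x.1, hb' x.1 x.2⟩, y.2.2⟩
    refine (hs ⟨y.1, y.2.1⟩).trans ?_
    exact mul_right_cancel₀ (algebraMap_frac_ne_zero (ne_zero_of_notMem (hbx x.1 x.2)))
      ((e x.1 x.2).trans h1.symm)
  exact ⟨⟨s, hloc⟩, hs ⟨genPt k N, hU⟩⟩

end ProjSpace

namespace ProjSpace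

open MvPolynomial ProjectiveSpectrum LineBundle

variable {k : Type u} [Field k] {N : ℕ}

lemma unitDeg_of_regDeg_inv {y : FormSpec k N} {m : ℤ} {g g' : FormFrac k N} (h : RegDeg y m g)
    (h' : RegDeg y (-m) g') (hg : g * g' = 1) : UnitDeg y m g := by
  obtain ⟨p, q, a, b, ha, hb, hby, hpq, e⟩ := h
  obtain ⟨p', q', a', b', ha', hb', hby', hpq', e'⟩ := h'
  refine ⟨p, q, a, b, ha, hb, fun hay => ?_, hby, hpq, e⟩
  have : a * a' = b * b' := by
    apply IsFractionRing.injective (FormRing k N) (FormFrac k N)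
    rw [map_mul, map_mul, ← e, ← e']
    linear_combination (algebraMap (FormRing k N) (FormFrac k N) b) *
      (algebraMap (FormRing k N) (FormFrac k N) b') * hg
  exact mul_notMem hby hby' (this ▸ Ideal.mul_mem_right _ _ hay)

lemma unitDeg_ev {U : (ProjSpace k N).Opens} {x : FormSpec k N} (hx : x ∈ U)
    (s : (Γ(ProjSpace k N, U))ˣ) : UnitDeg x 0 (ev U (genPt_mem hx) s) := by
  refine unitDeg_of_regDeg_inv (regDeg_ev hx _) (g' := ev U (genPt_mem hx) ↑s⁻¹) ?_ ?_
  · rw [neg_zero]; exact regDeg_ev hx _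
  · rw [← map_mul, Units.mul_inv, map_one]

lemma isUnit_of_unitDeg {U : (ProjSpace k N).Opens} (hU : genPt k N ∈ U)
    (s : Γ(ProjSpace k N, U)) (h : ∀ x ∈ U, UnitDeg x 0 (ev U hU s)) : IsUnit s := by
  obtain ⟨t, ht⟩ := exists_ev_eq U hU (ev U hU s)⁻¹ fun x hx => by
    simpa using (h x hx).inv.regDeg
  refine IsUnit.of_mul_eq_one t (ev_injective U hU ?_)
  rw [map_mul, ht, map_one, mul_inv_cancel₀ (h _ hU).ne_zero]

lemma mem_basicOpen_of_unitDeg {U : (ProjSpace k N).Opens} {x : FormSpec k N} (hx : x ∈ U)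
    (s : Γ(ProjSpace k N, U)) (h : UnitDeg x 0 (ev U (genPt_mem hx) s)) :
    x ∈ (ProjSpace k N).basicOpen s := by
  obtain ⟨p, q, a, b, ha, hb, hay, hby, hpq, e⟩ := h
  let V : (ProjSpace k N).Opens := U ⊓ Proj.basicOpen _ (a * b)
  have hxV : x ∈ V := ⟨hx, mul_notMem hay hby⟩
  have hu : IsUnit (sres _ (inf_le_left : V ≤ U) s) := by
    refine isUnit_of_unitDeg (genPt_mem hxV) _ fun y hy => ?_
    have hya : a * b ∉ y.asHomogeneousIdeal := hy.2
    exact ⟨p, q, a, b, ha, hb, fun h => hya (Ideal.mul_mem_right _ _ h),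
      fun h => hya (Ideal.mul_mem_left _ _ h), hpq, e⟩
  have h1 := (ProjSpace k N).basicOpen_of_isUnit hu
  have h2 : (ProjSpace k N).basicOpen (sres _ (inf_le_left : V ≤ U) s) =
      V ⊓ (ProjSpace k N).basicOpen s := Scheme.basicOpen_res _ _ _
  rw [h2] at h1
  have : x ∈ V ⊓ (ProjSpace k N).basicOpen s := h1 ▸ hxV
  exact this.2

instance (k : Type u) [Field k] (N : ℕ) : IsIntegral (ProjSpace k N) where
  nonempty := ⟨genPt k N⟩
  component_integral U hU := by
    obtain ⟨⟨x, hx⟩⟩ := hU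
    exact (ev_injective U (genPt_mem hx)).isDomain _

variable (k N) in
/-- The standard affine charts of projective space. -/
abbrev chart (i : Fin (N + 1)) : (ProjSpace k N).Opens :=
  Proj.basicOpen (homogeneousSubmodule (Fin (N + 1)) k) (X i)

lemma isAffineOpen_chart (i : Fin (N + 1)) : IsAffineOpen (chart k N i) :=
  Proj.isAffineOpen_basicOpen _ (X i) (isHomogeneous_X k i) one_pos

lemma mem_span_range_X {f : FormRing k N} (h0 : coeff 0 f = 0) :
    f ∈ Ideal.span (Set.range (X : Fin (N + 1) → FormRing k N)) := by
  rw [← Set.image_univ, mem_ideal_span_X_image]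
  intro m hm
  by_contra hcon
  push Not at hcon
  have : m = 0 := by ext i; simpa using hcon i (Set.mem_univ _)
  subst this
  exact mem_support_iff.1 hm h0

lemma irrelevant_le_of_X_mem {I : HomogeneousIdeal (homogeneousSubmodule (Fin (N + 1)) k)}
    (h : ∀ i, X i ∈ I) : HomogeneousIdeal.irrelevant (homogeneousSubmodule (Fin (N + 1)) k) ≤ I := by
  intro f hf
  have h0 : coeff 0 f = 0 := by
    have := (HomogeneousIdeal.mem_irrelevant_iff _ _).1 hf
    rw [GradedRing.proj_apply] at this
    have h1 : homogeneousComponent 0 f = 0 :=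
      (MvPolynomial.decomposition.decompose'_apply f 0).symm.trans this
    rw [homogeneousComponent_zero] at h1
    simpa using h1
  exact (Ideal.span_le (I := I.toIdeal)).2 (by rintro _ ⟨i, rfl⟩; exact h i) (mem_span_range_X h0)

lemma exists_mem_chart (x : FormSpec k N) : ∃ i, X i ∉ x.asHomogeneousIdeal := by
  by_contra! h
  exact x.not_irrelevant_le (irrelevant_le_of_X_mem h)

instance (k : Type u) [Field k] (N : ℕ) : CompactSpace (ProjSpace k N) := by
  constructor
  have : (Set.univ : Set (ProjSpace k N)) = ⋃ i, (chart k N i : Set (ProjSpace k N)) := by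
    refine (Set.eq_univ_of_forall fun x => ?_).symm
    obtain ⟨i, hi⟩ := exists_mem_chart x
    exact Set.mem_iUnion.2 ⟨i, hi⟩
  rw [this]
  exact isCompact_iUnion fun i => (isAffineOpen_chart i).isCompact

instance (k : Type u) [Field k] (N : ℕ) : (ProjSpace k N).IsSeparated := by
  unfold ProjSpace; infer_instance

lemma awayToSection_ev (f : FormRing k N) (h : genPt k N ∈ Proj.basicOpen _ f)
    (c : HomogeneousLocalization.NumDenSameDeg (homogeneousSubmodule (Fin (N + 1)) k)
      (Submonoid.powers f)) :
    ev _ h ((AlgebraicGeometry.Proj.awayToSection (homogeneousSubmodule (Fin (N + 1)) k) f).hom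
      (HomogeneousLocalization.mk c)) * algebraMap _ _ (c.den : FormRing k N) =
      algebraMap _ _ (c.num : FormRing k N) := by
  have hle : Submonoid.powers f ≤ (genPt k N).asHomogeneousIdeal.toIdeal.primeCompl :=
    (Submonoid.powers_le).2 h
  exact fracVal_mk_mul (genPt k N) ⟨c.deg, c.num, c.den, hle c.den_mem⟩

end ProjSpace

namespace LineBundle

lemma sres_self (X : Scheme.{u}) {U : X.Opens} (a : Γ(X, U)) : sres X (le_refl U) a = a :=
  congrArg (fun f : Γ(X, U) ⟶ Γ(X, U) => f.hom a) (X.presheaf.map_id (op U))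

lemma app_toSections {k : Type u} [Field k] {X Y : Scheme.{u}} (f : X ⟶ Y)
    (sY : Y ⟶ Spec (CommRingCat.of k)) (U : Y.Opens) (c : k) :
    (f.app U).hom (toSections sY U c) = toSections (f ≫ sY) (f ⁻¹ᵁ U) c := by
  have h := appLE_sres f (le_refl (f ⁻¹ᵁ U)) (le_top : U ≤ ⊤)
    (sY.appTop.hom ((Scheme.ΓSpecIso (CommRingCat.of k)).inv.hom c))
  have h2 := sres_appLE f (le_refl (f ⁻¹ᵁ ⊤)) (le_top : f ⁻¹ᵁ U ≤ f ⁻¹ᵁ ⊤)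
    (sY.appTop.hom ((Scheme.ΓSpecIso (CommRingCat.of k)).inv.hom c))
  rw [Scheme.Hom.appLE_eq_app] at h h2
  exact h.trans h2.symm

lemma toSections_toSpecΓ {k : Type u} [Field k] {X : Scheme.{u}} 
    (α : CommRingCat.of k ⟶ Γ(X, ⊤)) (c : k) :
    toSections (X.toSpecΓ ≫ Spec.map α) ⊤ c = α.hom c := by
  have h : (Scheme.ΓSpecIso (CommRingCat.of k)).inv ≫ (X.toSpecΓ ≫ Spec.map α).appTop = α := by
    rw [Scheme.Hom.comp_appTop, ← Scheme.ΓSpecIso_inv_naturality_assoc, Scheme.toSpecΓ_appTop]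
    simp
  exact (sres_self X _).trans (congrArg (fun f => f.hom c) h)

lemma eq_toSpecΓ {k : Type u} [Field k] {X : Scheme.{u}} (s : X ⟶ Spec (CommRingCat.of k)) :
    s = X.toSpecΓ ≫ Spec.map (CommRingCat.ofHom (toSections s ⊤)) := by
  have h : CommRingCat.ofHom (toSections s ⊤) =
      (Scheme.ΓSpecIso (CommRingCat.of k)).inv ≫ s.appTop := by
    ext c
    exact sres_self X _
  rw [h, Spec.map_comp, ← Scheme.toSpecΓ_naturality_assoc]
  simp

lemma toSections_injective {k : Type u} [Field k] {X : Scheme.{u}}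
    {s s' : X ⟶ Spec (CommRingCat.of k)}
    (h : ∀ c, toSections s ⊤ c = toSections s' ⊤ c) : s = s' := by
  rw [eq_toSpecΓ s, eq_toSpecΓ s', RingHom.ext h]

end LineBundle

namespace ProjSpace

open MvPolynomial ProjectiveSpectrum LineBundle

variable {k : Type u} [Field k] {N : ℕ}

lemma basicOpen_ι_toSpecZero {A σ : Type u} [CommRing A] [SetLike σ A] [AddSubgroupClass σ A]
    (𝒜 : ℕ → σ) [GradedRing 𝒜] {f : A} {m : ℕ} (hf : f ∈ 𝒜 m) (hm : 0 < m) :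
    (Proj.basicOpen 𝒜 f).ι ≫ Proj.toSpecZero 𝒜 = (Proj.basicOpen 𝒜 f).toScheme.toSpecΓ ≫
      Spec.map (CommRingCat.ofHom (HomogeneousLocalization.fromZeroRingHom 𝒜 _) ≫
        AlgebraicGeometry.Proj.awayToSection 𝒜 f ≫ (Proj.basicOpen 𝒜 f).topIso.inv) := by
  have h1 : (Proj.basicOpen 𝒜 f).ι = (Proj.basicOpenIsoSpec 𝒜 f hf hm).hom ≫
      Proj.awayι 𝒜 f hf hm := by
    simp [Proj.awayι]
  rw [h1, Category.assoc, Proj.awayι_toSpecZero, Proj.basicOpenIsoSpec_hom,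
    Proj.basicOpenToSpec, Scheme.Opens.toSpecΓ]
  simp only [Category.assoc, Spec.map_comp]

lemma ev_toSections (U : (ProjSpace k N).Opens) (h : genPt k N ∈ U) (c : k) :
    ev U h (toSections (str k N) U c) = algebraMap _ _ (C c : FormRing k N) := by
  let W := chart k N 0
  have hW : genPt k N ∈ W := notMem_genPt (X_ne_zero 0)
  have key : W.ι ≫ str k N = (W : Scheme).toSpecΓ ≫ Spec.map
      (CommRingCat.ofHom (degreeZeroInclusion k N) ≫ CommRingCat.ofHom
        (HomogeneousLocalization.fromZeroRingHom (homogeneousSubmodule (Fin (N + 1)) k) _) ≫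
        AlgebraicGeometry.Proj.awayToSection _ (X 0) ≫ W.topIso.inv) := by
    have h1 := basicOpen_ι_toSpecZero (homogeneousSubmodule (Fin (N + 1)) k) (f := X 0)
      (isHomogeneous_X k 0) one_pos
    rw [Spec.map_comp]
    exact (reassoc_of% h1) (Spec.map (CommRingCat.ofHom (degreeZeroInclusion k N)))
  have h1 := app_toSections W.ι (str k N) ⊤ c
  have h2 := (congrArg (fun s => toSections s ⊤ c) key).trans (toSections_toSpecΓ _ c)
  have hW' : genPt k N ∈ W.ι ''ᵁ (⊤ : (W : Scheme).Opens) := by simpa using hW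
  have h3 := congrArg (ev (W.ι ''ᵁ (⊤ : (W : Scheme).Opens)) hW') (h1.trans h2)
  have h4 := awayToSection_ev (X 0) hW ⟨0, ⟨C c, isHomogeneous_C _ _⟩, ⟨1, isHomogeneous_one _ _⟩,
    one_mem _⟩
  rw [map_one, mul_one] at h4
  refine Eq.trans ?_ (h3.trans h4)
  rw [← sres_toSections (str k N) le_top]
  rfl

end ProjSpace

namespace ProjSpace

open MvPolynomial ProjectiveSpectrum LineBundle

variable {k : Type u} [Field k] {N : ℕ}

/-- A generic trivialisation of a line bundle of degree `m` on projective space. -/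
structure IsFrame (M : LineBundle (ProjSpace k N)) (u : M.ι → FormFrac k N) (m : ℤ) : Prop where
  unitDeg : ∀ i, ∀ y ∈ M.U i, UnitDeg y (-m) (u i)
  trans : ∀ i j (h : genPt k N ∈ M.U i ⊓ M.U j),
    ev _ h (M.t i j : Γ(ProjSpace k N, M.U i ⊓ M.U j)) * u j = u i

lemma exists_mem_U {X : Scheme.{u}} (M : LineBundle X) (x : X) : ∃ i, x ∈ M.U i := by
  have : x ∈ iSup M.U := M.covers ▸ TopologicalSpace.Opens.mem_top x
  exact TopologicalSpace.Opens.mem_iSup.1 this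

lemma ev_cocycle (M : LineBundle (ProjSpace k N)) {i j l : M.ι} (hi : genPt k N ∈ M.U i)
    (hj : genPt k N ∈ M.U j) (hl : genPt k N ∈ M.U l) :
    ev (M.U i ⊓ M.U j) ⟨hi, hj⟩ (M.t i j) * ev (M.U j ⊓ M.U l) ⟨hj, hl⟩ (M.t j l) =
      ev (M.U i ⊓ M.U l) ⟨hi, hl⟩ (M.t i l) := by
  have h : genPt k N ∈ M.U i ⊓ M.U j ⊓ M.U l := ⟨⟨hi, hj⟩, hl⟩
  have := congrArg (fun a : (Γ(ProjSpace k N, M.U i ⊓ M.U j ⊓ M.U l))ˣ => ev _ h a.1)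
    (M.cocycle i j l)
  rw [← ev_sres (show M.U i ⊓ M.U j ⊓ M.U l ≤ M.U i ⊓ M.U l from
      le_inf (inf_le_left.trans inf_le_left) inf_le_right) h,
    ← ev_sres (show M.U i ⊓ M.U j ⊓ M.U l ≤ M.U i ⊓ M.U j from inf_le_left) h,
    ← ev_sres (show M.U i ⊓ M.U j ⊓ M.U l ≤ M.U j ⊓ M.U l from
          le_inf (inf_le_left.trans inf_le_right) inf_le_right) h, ← map_mul]
  exact this

lemma exists_isFrame (M : LineBundle (ProjSpace k N)) : ∃ u m, IsFrame M u m := by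
  classical
  obtain ⟨i₀, hi₀⟩ := exists_mem_U M (genPt k N)
  let f : M.ι → FormFrac k N := fun i =>
    if h : genPt k N ∈ M.U i then ev (M.U i ⊓ M.U i₀) ⟨h, hi₀⟩ (M.t i i₀) else 1
  have hf0 : ∀ i (h : genPt k N ∈ M.U i), f i = ev (M.U i ⊓ M.U i₀) ⟨h, hi₀⟩ (M.t i i₀) :=
    fun i h => dif_pos h
  have hf1 : ∀ i (h : genPt k N ∈ M.U i), UnitDeg (genPt k N) 0 (f i) := by
    intro i h
    rw [hf0 i h]
    exact unitDeg_ev (U := M.U i ⊓ M.U i₀) ⟨h, hi₀⟩ _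
  have hf2 : ∀ i j (hi : genPt k N ∈ M.U i) (hj : genPt k N ∈ M.U j),
      ev (M.U i ⊓ M.U j) ⟨hi, hj⟩ (M.t i j) * f j = f i := by
    intro i j hi hj
    rw [hf0 i hi, hf0 j hj, ev_cocycle M hi hj hi₀]
  obtain ⟨J, hJ⟩ := isCompact_univ.elim_finite_subcover (fun i => (M.U i : Set (ProjSpace k N)))
    (fun i => (M.U i).2) (fun x _ => Set.mem_iUnion.2 (exists_mem_U M x))
  have h3 : ∀ i, ∃ (p : ℕ) (a b : FormRing k N), a.IsHomogeneous p ∧ b.IsHomogeneous p ∧ a ≠ 0 ∧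
      b ≠ 0 ∧ f i * algebraMap _ _ b = algebraMap _ _ a := by
    intro i
    by_cases h : genPt k N ∈ M.U i
    · obtain ⟨p, q, a, b, ha, hb, hay, hby, hpq, e⟩ := hf1 i h
      obtain rfl : p = q := by omega
      exact ⟨p, a, b, ha, hb, ne_zero_of_notMem hay, ne_zero_of_notMem hby, e⟩
    · refine ⟨0, 1, 1, isHomogeneous_one _ _, isHomogeneous_one _ _, one_ne_zero, one_ne_zero, ?_⟩
      simp only [f, dif_neg h, one_mul]
  have h4 : ∀ i j (y : FormSpec k N), y ∈ M.U i → y ∈ M.U j → UnitDeg y 0 (f i / f j) := by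
    intro i j y hi hj
    rw [← hf2 i j (genPt_mem hi) (genPt_mem hj),
      mul_div_cancel_right₀ _ (hf1 j (genPt_mem hj)).ne_zero]
    exact unitDeg_ev (U := M.U i ⊓ M.U j) ⟨hi, hj⟩ _
  obtain ⟨g, m, hg⟩ := exists_unitDeg_mul (fun i => (M.U i : Set (ProjSpace k N)))
    (fun i y z hzy hy => mem_of_le (M.U i) hzy hy) J
    (fun y => by
      obtain ⟨j, hj, hy⟩ := Set.mem_iUnion₂.1 (hJ (Set.mem_univ y))
      exact ⟨j, hj, hy⟩) f h3 h4
  refine ⟨fun i => f i * g, -m, fun i y hy => by rw [neg_neg]; exact hg i y hy, fun i j h => ?_⟩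
  rw [← mul_assoc, hf2 i j h.1 h.2]

lemma IsFrame.pow {M : LineBundle (ProjSpace k N)} {u : M.ι → FormFrac k N} {m : ℤ}
    (h : IsFrame M u m) (r : ℕ) : IsFrame (M.pow r) (fun i => u i ^ r) (r * m) where
  unitDeg i y hy := by
    have := (h.unitDeg i y hy).pow r
    rwa [mul_neg] at this
  trans i j hij := by
    have := h.trans i j hij
    rw [← this, mul_pow, ← map_pow]
    rfl

section

variable {M : LineBundle (ProjSpace k N)} {u : M.ι → FormFrac k N} {m : ℤ}

lemma IsFrame.ne_zero (hM : IsFrame M u m) {i} (h : genPt k N ∈ M.U i) : u i ≠ 0 :=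
  (hM.unitDeg i _ h).ne_zero

/-- Compatible local sections come from a form. -/
lemma IsFrame.exists_form (hM : IsFrame M u m) (hN : 1 ≤ N) (s : ∀ i, Γ(ProjSpace k N, M.U i))
    (hs : ∀ i j, sres _ (inf_le_left : M.U i ⊓ M.U j ≤ M.U i) (s i)
      = (M.t i j : Γ(ProjSpace k N, M.U i ⊓ M.U j)) * sres _ inf_le_right (s j)) :
    ∃ g : FormFrac k N, (∀ i h, ev (M.U i) h (s i) = g * u i) ∧
      (g = 0 ∨ ∃ (n : ℕ) (F : FormRing k N), (n : ℤ) = m ∧ F.IsHomogeneous n ∧ g = algebraMap (FormRing k N) _ F) := by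
  obtain ⟨i₀, hi₀⟩ := exists_mem_U M (genPt k N)
  have key : ∀ i h, ev (M.U i) h (s i) = ev (M.U i₀) hi₀ (s i₀) / u i₀ * u i := by
    intro i h
    have h1 : genPt k N ∈ M.U i ⊓ M.U i₀ := ⟨h, hi₀⟩
    have h2 := congrArg (ev _ h1) (hs i i₀)
    rw [map_mul] at h2
    have h3 := hM.trans i i₀ h1
    rw [← h3, mul_comm (_ / _), mul_assoc, mul_div_cancel₀ _ (hM.ne_zero hi₀)]
    exact h2
  refine ⟨_, key, exists_isHomogeneous_of_regDeg hN (fun y => ?_) (genPt k N)⟩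
  obtain ⟨i, hi⟩ := exists_mem_U M y
  have h1 : ev (M.U i₀) hi₀ (s i₀) / u i₀ = ev (M.U i) (genPt_mem hi) (s i) * (u i)⁻¹ := by
    rw [key i, mul_inv_cancel_right₀ (hM.ne_zero (genPt_mem hi))]
  rw [h1]
  have := (regDeg_ev hi (s i)).mul (hM.unitDeg i y hi).inv.regDeg
  simpa using this

/-- A form of the right degree defines a section. -/
lemma IsFrame.exists_section (hM : IsFrame M u m) {n : ℕ} (hn : (n : ℤ) = m) {F : FormRing k N}
    (hF : F.IsHomogeneous n) : ∃ σ : GlobalSec M, ∀ i h, ev (M.U i) h (σ.s i) =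
      algebraMap _ _ F * u i := by
  have : ∀ i, ∃ s : Γ(ProjSpace k N, M.U i), ∀ h, ev (M.U i) h s = algebraMap _ _ F * u i := by
    intro i
    by_cases h : genPt k N ∈ M.U i
    · obtain ⟨s, hs⟩ := exists_ev_eq (M.U i) h (algebraMap _ _ F * u i) fun x hx => by
        have := (RegDeg.of_isHomogeneous hF x).mul (hM.unitDeg i x hx).regDeg
        rwa [hn, add_neg_cancel] at this
      exact ⟨s, fun _ => hs⟩
    · exact ⟨0, fun h' => absurd h' h⟩
  choose s hs using this
  refine ⟨⟨s, fun i j => ?_⟩, hs⟩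
  by_cases h : genPt k N ∈ M.U i ⊓ M.U j
  · apply ev_injective _ h
    rw [map_mul, ev_sres, ev_sres, hs, hs, ← hM.trans i j h]
    ring
  · apply Proj.ext
    funext ⟨x, hx⟩
    exact absurd (genPt_mem hx) h

end

end ProjSpace

namespace ProjSpace

open MvPolynomial ProjectiveSpectrum LineBundle

variable {k : Type u} [Field k] {N : ℕ}

section

variable {M : LineBundle (ProjSpace k N)} {u : M.ι → FormFrac k N} {m : ℤ}

lemma IsFrame.h0_eq (hM : IsFrame M u m) {W : Submodule k (FormFrac k N)}
    (h1 : ∀ s : ∀ i, Γ(ProjSpace k N, M.U i),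
      (∀ i j, sres _ (inf_le_left : M.U i ⊓ M.U j ≤ M.U i) (s i)
        = (M.t i j : Γ(ProjSpace k N, M.U i ⊓ M.U j)) * sres _ inf_le_right (s j)) →
      ∃ g ∈ W, ∀ i h, ev (M.U i) h (s i) = g * u i)
    (h2 : ∀ g ∈ W, ∃ σ : GlobalSec M, ∀ i h, ev (M.U i) h (σ.s i) = g * u i) :
    h0 (str k N) M = Module.finrank k W := by
  let _ : ∀ i, Module k Γ(ProjSpace k N, M.U i) := fun i => (toSections (str k N) (M.U i)).toModule
  obtain ⟨i₀, hi₀⟩ := exists_mem_U M (genPt k N)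
  let Φ : secSubmodule (str k N) M →ₗ[k] FormFrac k N :=
    { toFun := fun s => ev (M.U i₀) hi₀ (s.1 i₀) / u i₀
      map_add' := fun s t => by
        rw [← add_div, ← map_add]
        rfl
      map_smul' := fun c s => by
        rw [RingHom.id_apply, Algebra.smul_def, IsScalarTower.algebraMap_apply k (FormRing k N),
          MvPolynomial.algebraMap_eq, ← ev_toSections (M.U i₀) hi₀, ← mul_div_assoc, ← map_mul]
        rfl }
  have hu := hM.ne_zero hi₀
  have hΦ : ∀ s g, (∀ i h, ev (M.U i) h (s.1 i) = g * u i) → Φ s = g := fun s g h => by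
    change ev (M.U i₀) hi₀ (s.1 i₀) / u i₀ = g
    rw [h, mul_div_cancel_right₀ _ hu]
  have hinj : Function.Injective Φ := by
    rw [← LinearMap.ker_eq_bot, LinearMap.ker_eq_bot']
    intro s hs
    obtain ⟨g, -, hg⟩ := h1 s.1 s.2
    have h0 : g = 0 := (hΦ s g hg).symm.trans hs
    apply Subtype.ext
    funext i
    by_cases h : genPt k N ∈ M.U i
    · apply ev_injective _ h
      rw [hg i h, h0, zero_mul]
      exact (map_zero _).symm
    · apply Proj.ext
      funext ⟨x, hx⟩
      exact absurd (genPt_mem hx) h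
  have hrange : LinearMap.range Φ = W := by
    ext g
    constructor
    · rintro ⟨s, rfl⟩
      obtain ⟨g, hgW, hg⟩ := h1 s.1 s.2
      rwa [hΦ s g hg]
    · intro hg
      obtain ⟨σ, hσ⟩ := h2 g hg
      exact ⟨⟨σ.s, σ.compat⟩, hΦ ⟨σ.s, σ.compat⟩ g hσ⟩
  rw [← hrange, LinearMap.finrank_range_of_inj hinj]
  rfl

lemma IsFrame.h0_eq_zero (hM : IsFrame M u m) (hN : 1 ≤ N) (hm : m < 0) :
    h0 (str k N) M = 0 := by
  rw [hM.h0_eq (W := ⊥), finrank_bot]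
  · intro s hs
    obtain ⟨g, hg, h⟩ := hM.exists_form hN s hs
    rcases h with h | ⟨n, F, hn, -⟩
    · exact ⟨g, (Submodule.mem_bot k).2 h, hg⟩
    · omega
  · intro g hg
    rw [(Submodule.mem_bot k).1 hg]
    exact ⟨⟨fun _ => 0, fun i j => by simp⟩, fun i h => by simp⟩

lemma IsFrame.h0_eq_finrank {n : ℕ} (hM : IsFrame M u n) (hN : 1 ≤ N) :
    h0 (str k N) M = Module.finrank k (homogeneousSubmodule (Fin (N + 1)) k n) := by
  let f : FormRing k N →ₗ[k] FormFrac k N :=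
    (IsScalarTower.toAlgHom k (FormRing k N) (FormFrac k N)).toLinearMap
  have hf : Function.Injective f := IsFractionRing.injective (FormRing k N) (FormFrac k N)
  rw [hM.h0_eq (W := (homogeneousSubmodule (Fin (N + 1)) k n).map f)]
  · exact (Submodule.equivMapOfInjective f hf _).finrank_eq.symm
  · intro s hs
    obtain ⟨g, hg, h⟩ := hM.exists_form hN s hs
    refine ⟨g, ?_, hg⟩
    rcases h with rfl | ⟨n', F, hn, hF, rfl⟩
    · exact Submodule.zero_mem _
    · obtain rfl : n' = n := by exact_mod_cast hn
      exact ⟨F, hF, rfl⟩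
  · rintro _ ⟨F, hF, rfl⟩
    exact hM.exists_section rfl hF

end

lemma exists_isFrame_one {O1 : LineBundle (ProjSpace k N)} (hN : 1 ≤ N)
    (hO1 : IsTautologicalBundle k N O1) : ∃ u, IsFrame O1 u 1 := by
  obtain ⟨u, m, hu⟩ := exists_isFrame O1
  refine ⟨u, ?_⟩
  suffices m = 1 by rwa [this] at hu
  have h1 := hu.pow 1
  rw [Nat.cast_one, one_mul] at h1
  have h2 := hO1 1
  rw [Nat.choose_succ_self_right] at h2
  rcases lt_or_ge m 0 with hm | hm
  · rw [h1.h0_eq_zero hN hm] at h2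
    omega
  · lift m to ℕ using hm
    rw [h1.h0_eq_finrank hN] at h2
    have : Module.Finite k (homogeneousSubmodule (Fin (N + 1)) k m) :=
      Module.finite_of_finrank_pos (by omega)
    rcases m with _ | _ | m
    · rw [finrank_homogeneousSubmodule_zero] at h2
      omega
    · rfl
    · have := card_lt_finrank_homogeneousSubmodule (k := k) hN (show 2 ≤ m + 1 + 1 by omega) inferInstance
      omega

end ProjSpace

section GenericValue

variable {X : Scheme.{u}} [IsIntegral X]

lemma generic_mem {U : X.Opens} {x : X} (hx : x ∈ U) : genericPoint X ∈ U :=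
  ((genericPoint_spec X).mem_open_set_iff U.2).2 ⟨x, trivial, hx⟩

/-- The germ at the generic point of a section over a nonempty open. -/
def gv (U : X.Opens) (h : genericPoint X ∈ U) : Γ(X, U) →+* X.functionField :=
  (X.presheaf.germ U _ h).hom

lemma gv_sres {U V : X.Opens} (hVU : V ≤ U) (h : genericPoint X ∈ V) (s : Γ(X, U)) :
    gv V h (sres X hVU s) = gv U (hVU h) s :=
  X.presheaf.germ_res_apply (homOfLE hVU) _ h s

lemma gv_injective (U : X.Opens) (h : genericPoint X ∈ U) : Function.Injective (gv U h) :=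
  germ_injective_of_isIntegral X _ h

/-- `g` is a regular function near `x`. -/
def RegAt (x : X) (g : X.functionField) : Prop :=
  ∃ (U : X.Opens) (hx : x ∈ U) (s : Γ(X, U)), gv U (generic_mem hx) s = g

/-- `g` is an invertible regular function near `x`. -/
def UnitAt (x : X) (g : X.functionField) : Prop :=
  ∃ (U : X.Opens) (hx : x ∈ U) (s : (Γ(X, U))ˣ), gv U (generic_mem hx) s = g

lemma regAt_gv {U : X.Opens} {x : X} (hx : x ∈ U) (s : Γ(X, U)) :
    RegAt x (gv U (generic_mem hx) s) := ⟨U, hx, s, rfl⟩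

lemma unitAt_gv {U : X.Opens} {x : X} (hx : x ∈ U) (s : (Γ(X, U))ˣ) :
    UnitAt x (gv U (generic_mem hx) s) := ⟨U, hx, s, rfl⟩

variable {x : X} {g g' : X.functionField}

lemma UnitAt.regAt (h : UnitAt x g) : RegAt x g := by
  obtain ⟨U, hx, s, e⟩ := h
  exact ⟨U, hx, s, e⟩

lemma RegAt.mul (h : RegAt x g) (h' : RegAt x g') : RegAt x (g * g') := by
  obtain ⟨U, hx, s, e⟩ := h
  obtain ⟨U', hx', s', e'⟩ := h'
  refine ⟨U ⊓ U', ⟨hx, hx'⟩, sres X inf_le_left s * sres X inf_le_right s', ?_⟩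
  rw [map_mul, gv_sres, gv_sres, e, e']

lemma UnitAt.mul (h : UnitAt x g) (h' : UnitAt x g') : UnitAt x (g * g') := by
  obtain ⟨U, hx, s, e⟩ := h
  obtain ⟨U', hx', s', e'⟩ := h'
  refine ⟨U ⊓ U', ⟨hx, hx'⟩, Units.map (sres X inf_le_left).toMonoidHom s *
    Units.map (sres X inf_le_right).toMonoidHom s', ?_⟩
  rw [← e, ← e', ← gv_sres inf_le_left (generic_mem (U := U ⊓ U') ⟨hx, hx'⟩),
    ← gv_sres inf_le_right (generic_mem (U := U ⊓ U') ⟨hx, hx'⟩), ← map_mul]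
  rfl

lemma UnitAt.inv (h : UnitAt x g) : UnitAt x g⁻¹ := by
  obtain ⟨U, hx, s, rfl⟩ := h
  refine ⟨U, hx, s⁻¹, ?_⟩
  refine eq_inv_of_mul_eq_one_left ?_
  rw [← map_mul, Units.inv_mul, map_one]

lemma UnitAt.ne_zero (h : UnitAt x g) : g ≠ 0 := by
  obtain ⟨U, hx, s, rfl⟩ := h
  exact (s.isUnit.map _).ne_zero

lemma UnitAt.pow (h : UnitAt x g) (n : ℕ) : UnitAt x (g ^ n) := by
  obtain ⟨U, hx, s, rfl⟩ := h
  exact ⟨U, hx, s ^ n, by simp⟩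

lemma exists_gv_eq (U : X.Opens) (hU : genericPoint X ∈ U) (g : X.functionField)
    (h : ∀ x ∈ U, RegAt x g) : ∃ s : Γ(X, U), gv U hU s = g := by
  choose V hV s hs using fun x : U => h x.1 x.2
  obtain ⟨t, ht, -⟩ := X.sheaf.existsUnique_gluing' (fun x : U => V x ⊓ U) U
    (fun x => homOfLE inf_le_right)
    (fun y hy => TopologicalSpace.Opens.mem_iSup.2 ⟨⟨y, hy⟩, hV ⟨y, hy⟩, hy⟩)
    (fun x => sres X inf_le_left (s x)) (fun x y => by
      have hxy : genericPoint X ∈ (V x ⊓ U) ⊓ (V y ⊓ U) :=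
        ⟨⟨generic_mem (hV x), hU⟩, ⟨generic_mem (hV y), hU⟩⟩
      apply gv_injective _ hxy
      change gv _ _ (sres X inf_le_left (sres X inf_le_left (s x))) =
        gv _ _ (sres X inf_le_right (sres X inf_le_left (s y)))
      rw [gv_sres, gv_sres, gv_sres, gv_sres, hs, hs])
  refine ⟨t, ?_⟩
  have h1 : sres X inf_le_right t = sres X inf_le_left (s ⟨_, hU⟩) := ht ⟨_, hU⟩
  have h2 := congrArg (gv (V ⟨_, hU⟩ ⊓ U) ⟨hV ⟨_, hU⟩, hU⟩) h1
  exact (gv_sres _ _ _).symm.trans (h2.trans ((gv_sres _ _ _).trans (hs ⟨_, hU⟩)))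

/-- A trivialisation of a line bundle at the generic point. -/
structure IsGenFrame (M : LineBundle X) (w : M.ι → X.functionField) : Prop where
  ne_zero : ∀ i, w i ≠ 0
  trans : ∀ i j (h : genericPoint X ∈ M.U i ⊓ M.U j), gv _ h (M.t i j : Γ(X, M.U i ⊓ M.U j)) * w j = w i

lemma gv_cocycle (M : LineBundle X) {i j l : M.ι} (hi : genericPoint X ∈ M.U i)
    (hj : genericPoint X ∈ M.U j) (hl : genericPoint X ∈ M.U l) :
    gv (M.U i ⊓ M.U j) ⟨hi, hj⟩ (M.t i j) * gv (M.U j ⊓ M.U l) ⟨hj, hl⟩ (M.t j l) =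
      gv (M.U i ⊓ M.U l) ⟨hi, hl⟩ (M.t i l) := by
  have h : genericPoint X ∈ M.U i ⊓ M.U j ⊓ M.U l := ⟨⟨hi, hj⟩, hl⟩
  have := congrArg (fun a : (Γ(X, M.U i ⊓ M.U j ⊓ M.U l))ˣ => gv _ h a.1) (M.cocycle i j l)
  rw [← gv_sres (show M.U i ⊓ M.U j ⊓ M.U l ≤ M.U i ⊓ M.U l from
      le_inf (inf_le_left.trans inf_le_left) inf_le_right) h,
    ← gv_sres (show M.U i ⊓ M.U j ⊓ M.U l ≤ M.U i ⊓ M.U j from inf_le_left) h,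
    ← gv_sres (show M.U i ⊓ M.U j ⊓ M.U l ≤ M.U j ⊓ M.U l from
          le_inf (inf_le_left.trans inf_le_right) inf_le_right) h, ← map_mul]
  exact this

lemma exists_isGenFrame (M : LineBundle X) : ∃ w, IsGenFrame M w := by
  classical
  obtain ⟨i₀, hi₀⟩ := ProjSpace.exists_mem_U M (genericPoint X)
  let f : M.ι → X.functionField := fun i =>
    if h : genericPoint X ∈ M.U i then gv (M.U i ⊓ M.U i₀) ⟨h, hi₀⟩ (M.t i i₀) else 1
  have hf : ∀ i (h : genericPoint X ∈ M.U i), f i = gv (M.U i ⊓ M.U i₀) ⟨h, hi₀⟩ (M.t i i₀) :=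
    fun i h => dif_pos h
  refine ⟨f, fun i => ?_, fun i j h => ?_⟩
  · by_cases h : genericPoint X ∈ M.U i
    · rw [hf i h]
      exact ((M.t i i₀).isUnit.map _).ne_zero
    · rw [show f i = 1 from dif_neg h]
      exact one_ne_zero
  · rw [hf i h.1, hf j h.2, gv_cocycle M h.1 h.2 hi₀]

lemma IsGenFrame.pow {M : LineBundle X} {w : M.ι → X.functionField} (hw : IsGenFrame M w) (n : ℕ) :
    IsGenFrame (M.pow n) (fun i => w i ^ n) where
  ne_zero i := pow_ne_zero _ (hw.ne_zero i)
  trans i j h := by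
    rw [← hw.trans i j h, mul_pow, ← map_pow]
    rfl

lemma IsGenFrame.unitAt_div {M : LineBundle X} {w : M.ι → X.functionField} (hw : IsGenFrame M w)
    {i j : M.ι} {x : X} (hi : x ∈ M.U i) (hj : x ∈ M.U j) : UnitAt x (w i / w j) := by
  rw [← hw.trans i j ⟨generic_mem hi, generic_mem hj⟩, mul_div_cancel_right₀ _ (hw.ne_zero j)]
  exact unitAt_gv (U := M.U i ⊓ M.U j) ⟨hi, hj⟩ _

/-- Multiplication by `h` identifies two generically trivialised line bundles. -/
def FrameRel (L : LineBundle X) (w : L.ι → X.functionField) (M : LineBundle X)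
    (w' : M.ι → X.functionField) (h : X.functionField) : Prop :=
  ∀ x i j, x ∈ L.U i → x ∈ M.U j → UnitAt x (w i / (h * w' j))

lemma LineBundle.EquivLB.exists_frameRel {L M : LineBundle X} (e : L.EquivLB M)
    {w : L.ι → X.functionField} (hw : IsGenFrame L w) {w' : M.ι → X.functionField}
    (hw' : IsGenFrame M w') : ∃ h ≠ 0, FrameRel L w M w' h := by
  obtain ⟨κ, V, hV, a, b, ha, hb, s, hs⟩ := e
  have hmem : ∀ x, ∃ c, x ∈ V c := fun x =>
    TopologicalSpace.Opens.mem_iSup.1 (hV ▸ TopologicalSpace.Opens.mem_top x)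
  obtain ⟨c₀, hc₀⟩ := hmem (genericPoint X)
  have hs0 : ∀ c (hc : genericPoint X ∈ V c), gv (V c) hc (s c) ≠ 0 :=
    fun c hc => ((s c).isUnit.map _).ne_zero
  have key : ∀ c (hc : genericPoint X ∈ V c), w (a c) * (gv (V c₀) hc₀ (s c₀) * w' (b c₀)) =
      w (a c₀) * (gv (V c) hc (s c) * w' (b c)) := by
    intro c hc
    have hcc : genericPoint X ∈ V c ⊓ V c₀ := ⟨hc, hc₀⟩
    have h1 := congrArg (fun a : (Γ(X, V c ⊓ V c₀))ˣ => gv _ hcc a.1) (hs c c₀)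
    have h2 : gv _ hcc (sres X (le_inf ((inf_le_left.trans (ha c)))
          (inf_le_right.trans (ha c₀)) : V c ⊓ V c₀ ≤ L.U (a c) ⊓ L.U (a c₀)) (L.t (a c) (a c₀)))
        * gv _ hcc (sres X (inf_le_right : V c ⊓ V c₀ ≤ V c₀) (s c₀)) =
        gv _ hcc (sres X (inf_le_left : V c ⊓ V c₀ ≤ V c) (s c)) *
        gv _ hcc (sres X (le_inf ((inf_le_left.trans (hb c)))
            (inf_le_right.trans (hb c₀)) : V c ⊓ V c₀ ≤ M.U (b c) ⊓ M.U (b c₀)) (M.t (b c) (b c₀))) := by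
      rw [← map_mul, ← map_mul]
      exact h1
    rw [gv_sres, gv_sres, gv_sres, gv_sres] at h2
    have h3 := hw.trans (a c) (a c₀) ⟨ha c hc, ha c₀ hc₀⟩
    have h4 := hw'.trans (b c) (b c₀) ⟨hb c hc, hb c₀ hc₀⟩
    rw [← h3, ← h4]
    linear_combination (w (a c₀) * w' (b c₀)) * h2
  refine ⟨w (a c₀) / (gv (V c₀) hc₀ (s c₀) * w' (b c₀)),
    div_ne_zero (hw.ne_zero _) (mul_ne_zero (hs0 _ _) (hw'.ne_zero _)), fun x i j hi hj => ?_⟩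
  obtain ⟨c, hc⟩ := hmem x
  have h1 := ((hw.unitAt_div hi (ha c hc)).mul (hw'.unitAt_div (hb c hc) hj)).mul (unitAt_gv hc (s c))
  have h2 := key c (generic_mem hc)
  have h3 := hs0 c (generic_mem hc)
  have h4 := hs0 c₀ hc₀
  have := hw.ne_zero (a c₀)
  have := hw.ne_zero (a c)
  have := hw'.ne_zero (b c₀)
  have := hw'.ne_zero j
  convert h1 using 1
  generalize gv (V c) (generic_mem hc) (s c) = A at *
  generalize gv (V c₀) hc₀ (s c₀) = B at *
  field_simp
  linear_combination (w i) * h2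

lemma FrameRel.pow {L M : LineBundle X} {w : L.ι → X.functionField} {w' : M.ι → X.functionField}
    {h : X.functionField} (e : FrameRel L w M w' h) (n : ℕ) :
    FrameRel (L.pow n) (fun i => w i ^ n) (M.pow n) (fun i => w' i ^ n) (h ^ n) := by
  intro x i j hi hj
  rw [← mul_pow, ← div_pow]
  exact (e x i j hi hj).pow n

lemma FrameRel.trans {L M P : LineBundle X} {w : L.ι → X.functionField} {w' : M.ι → X.functionField}
    {w'' : P.ι → X.functionField} {h h' : X.functionField} (e : FrameRel L w M w' h)
    (e' : FrameRel M w' P w'' h') : FrameRel L w P w'' (h * h') := by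
  intro x i l hi hl
  obtain ⟨j, hj⟩ := ProjSpace.exists_mem_U M x
  have h1 := (e x i j hi hj).mul (e' x j l hj hl)
  have h2 : w' j ≠ 0 := (div_ne_zero_iff.1 (e' x j l hj hl).ne_zero).1
  convert h1 using 1
  rw [div_mul_div_comm, show h * w' j * (h' * w'' l) = h * h' * w'' l * w' j by ring,
    mul_div_mul_right _ _ h2]

lemma FrameRel.symm {L M : LineBundle X} {w : L.ι → X.functionField} {w' : M.ι → X.functionField}
    {h : X.functionField} (e : FrameRel L w M w' h) : FrameRel M w' L w h⁻¹ := by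
  intro x i j hi hj
  convert (e x j i hj hi).inv using 1
  rw [inv_div, mul_comm h⁻¹, ← div_eq_mul_inv, div_div_eq_mul_div, mul_comm h]

end GenericValue

namespace LineBundle

variable {X Y : Scheme.{u}}

lemma EquivLB.pullbackLB (f : X ⟶ Y) {L M : LineBundle Y} (e : L.EquivLB M) :
    (pullbackLB f L).EquivLB (pullbackLB f M) := by
  obtain ⟨κ, V, hV, a, b, ha, hb, s, hs⟩ := e
  refine ⟨κ, fun c => f ⁻¹ᵁ V c, ?_, a, b, fun c => preimage_mono f (ha c),
    fun c => preimage_mono f (hb c),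
    fun c => Units.map (f.appLE (V c) (f ⁻¹ᵁ V c) le_rfl).hom.toMonoidHom (s c), fun c c' => ?_⟩
  · rw [← Scheme.Hom.preimage_iSup, hV]
    rfl
  · have key := congrArg (Units.map (f.appLE (V c ⊓ V c')
        (f ⁻¹ᵁ V c ⊓ f ⁻¹ᵁ V c') (preimage_inf f _ _).ge).hom.toMonoidHom) (hs c c')
    rw [map_mul, map_mul, unit_appLE_sres, unit_appLE_sres, unit_appLE_sres, unit_appLE_sres] at key
    have hle : f ⁻¹ᵁ V c ⊓ f ⁻¹ᵁ V c' ≤ f ⁻¹ᵁ V c ⊓ f ⁻¹ᵁ V c' := le_rfl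
    exact (congrArg₂ (· * ·)
      (unit_sres_appLE f (preimage_inf f (L.U (a c)) (L.U (a c'))).ge
        (hle.trans (inf_le_inf (preimage_mono f (ha c)) (preimage_mono f (ha c')))) _)
      (unit_sres_appLE f le_rfl inf_le_right _)).trans (key.trans (congrArg₂ (· * ·)
      (unit_sres_appLE f le_rfl inf_le_left _)
      (unit_sres_appLE f (preimage_inf f (M.U (b c)) (M.U (b c'))).ge
        (hle.trans (inf_le_inf (preimage_mono f (hb c)) (preimage_mono f (hb c')))) _)).symm)

end LineBundle

lemma MvPolynomial.eval₂_mul_of_isHomogeneous {R A σ : Type*} [CommSemiring R] [CommSemiring A]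
    {F : MvPolynomial σ R} {n : ℕ} (hF : F.IsHomogeneous n) (f : R →+* A) (r : A) (g : σ → A) :
    eval₂ f (fun i => r * g i) F = r ^ n * eval₂ f g F := by
  rw [eval₂_eq, eval₂_eq, Finset.mul_sum]
  refine Finset.sum_congr rfl fun m hm => ?_
  have h : ∑ i ∈ m.support, m i = n := by
    have := hF (mem_support_iff.1 hm)
    rwa [Finsupp.weight_apply, Finsupp.sum, Finset.sum_congr rfl fun i _ => by
      rw [Pi.one_apply, smul_eq_mul, mul_one]] at this
  simp_rw [mul_pow]
  rw [Finset.prod_mul_distrib, Finset.prod_pow_eq_pow_sum, h]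
  ring

namespace ProjSpace

open MvPolynomial ProjectiveSpectrum LineBundle

variable {k : Type u} [Field k] {N : ℕ}

lemma genPt_mem_chart (b : Fin (N + 1)) : genPt k N ∈ chart k N b := notMem_genPt (X_ne_zero b)

lemma exists_coordSec (b l : Fin (N + 1)) : ∃ s : Γ(ProjSpace k N, chart k N b),
    ev _ (genPt_mem_chart b) s * algebraMap _ _ (X b : FormRing k N) =
      algebraMap _ _ (X l : FormRing k N) := by
  have hb : algebraMap (FormRing k N) (FormFrac k N) (X b) ≠ 0 := algebraMap_frac_ne_zero (X_ne_zero b)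
  obtain ⟨s, hs⟩ := exists_ev_eq (chart k N b) (genPt_mem_chart b)
    (algebraMap _ _ (X l : FormRing k N) / algebraMap _ _ (X b : FormRing k N))
    fun x hx => ⟨1, 1, X l, X b, isHomogeneous_X k l, isHomogeneous_X k b, hx, by simp,
      div_mul_cancel₀ _ hb⟩
  exact ⟨s, by rw [hs, div_mul_cancel₀ _ hb]⟩

/-- The coordinate function `X l / X b` on a standard chart. -/
def coordSec (b l : Fin (N + 1)) : Γ(ProjSpace k N, chart k N b) := (exists_coordSec b l).choose

lemma ev_coordSec_mul (b l : Fin (N + 1)) :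
    ev _ (genPt_mem_chart b) (coordSec (k := k) b l) * algebraMap _ _ (X b : FormRing k N) =
      algebraMap _ _ (X l : FormRing k N) := (exists_coordSec b l).choose_spec

lemma coordSec_self (b : Fin (N + 1)) : coordSec (k := k) b b = 1 := by
  apply ev_injective _ (genPt_mem_chart b)
  rw [map_one]
  exact mul_right_cancel₀ (algebraMap_frac_ne_zero (X_ne_zero b))
    ((ev_coordSec_mul b b).trans (one_mul _).symm)

/-- Dehomogenisation of polynomials on a standard chart. -/
def chartHom (b : Fin (N + 1)) : FormRing k N →+* Γ(ProjSpace k N, chart k N b) :=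
  eval₂Hom (toSections (str k N) (chart k N b)) (coordSec b)

lemma ev_chartHom_mul (b : Fin (N + 1)) {F : FormRing k N} {n : ℕ} (hF : F.IsHomogeneous n) :
    ev _ (genPt_mem_chart b) (chartHom b F) * algebraMap _ _ (X b : FormRing k N) ^ n =
      algebraMap _ _ F := by
  have h1 : ev _ (genPt_mem_chart b) (chartHom b F) =
      eval₂ (algebraMap k (FormFrac k N)) (fun l => ev _ (genPt_mem_chart b) (coordSec (k := k) b l)) F := by
    rw [chartHom, coe_eval₂Hom, hom_eval₂]
    congr 1
    ext c
    rw [RingHom.comp_apply, ev_toSections, IsScalarTower.algebraMap_apply k (FormRing k N),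
      MvPolynomial.algebraMap_eq]
  rw [h1, mul_comm, ← eval₂_mul_of_isHomogeneous hF]
  simp_rw [mul_comm (algebraMap (FormRing k N) (FormFrac k N) (X b)), ev_coordSec_mul]
  exact (aeval_algebraMap_apply (FormFrac k N) X F).trans (by rw [aeval_X_left_apply])

lemma exists_eq_chartHom (b : Fin (N + 1)) (s : Γ(ProjSpace k N, chart k N b)) :
    ∃ F : FormRing k N, s = chartHom b F := by
  obtain ⟨a, rfl⟩ : ∃ a, (AlgebraicGeometry.Proj.awayToSection
      (homogeneousSubmodule (Fin (N + 1)) k) (X b)).hom a = s :=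
    ⟨_, CategoryTheory.Iso.inv_hom_id_apply (AlgebraicGeometry.Proj.basicOpenIsoAway
      (homogeneousSubmodule (Fin (N + 1)) k) (X b) (isHomogeneous_X k b) one_pos) s⟩
  obtain ⟨c, rfl⟩ := HomogeneousLocalization.mk_surjective a
  obtain ⟨n, hn⟩ := c.den_mem
  have h := awayToSection_ev (X b) (genPt_mem_chart b) c
  refine ⟨c.num, ev_injective _ (genPt_mem_chart b) ?_⟩
  have hn' : X b ^ n = (c.den : FormRing k N) := hn
  have hdeg : c.deg = n := by
    have h1 : (c.den : FormRing k N).IsHomogeneous n := by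
      rw [← hn']
      simpa using (isHomogeneous_X k b).pow n
    exact (c.den.2 : (c.den : FormRing k N).IsHomogeneous c.deg).inj_right h1
      (hn' ▸ pow_ne_zero _ (X_ne_zero b))
  have h2 := ev_chartHom_mul b (F := (c.num : FormRing k N)) (n := n) (by
    rw [← hdeg]
    exact c.num.2)
  rw [← hn', map_pow] at h
  exact mul_right_cancel₀ (pow_ne_zero n (algebraMap_frac_ne_zero (X_ne_zero b))) (h.trans h2.symm)

lemma chart_hom_ext {R : Type*} [CommRing R] {b : Fin (N + 1)}
    {f g : Γ(ProjSpace k N, chart k N b) →+* R}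
    (h1 : ∀ c, f (toSections (str k N) _ c) = g (toSections (str k N) _ c))
    (h2 : ∀ l, f (coordSec b l) = g (coordSec b l)) : f = g := by
  have : f.comp (chartHom b) = g.comp (chartHom b) := by
    apply MvPolynomial.ringHom_ext
    · intro c
      simpa [chartHom] using h1 c
    · intro l
      simpa [chartHom] using h2 l
  ext s
  obtain ⟨F, rfl⟩ := exists_eq_chartHom b s
  exact congrArg (fun f => f F) this

lemma exists_away_hom {R : Type u} [CommRing R] (g : FormRing k N →+* R) (x : FormRing k N)
    (hx : g x = 1) :
    ∃ f : HomogeneousLocalization.Away (homogeneousSubmodule (Fin (N + 1)) k) x →+* R,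
      ∀ c, f (HomogeneousLocalization.mk c) = g c.num := by
  have hg : ∀ y : Submonoid.powers x, g y = 1 := by
    rintro ⟨_, n, rfl⟩
    simp [hx]
  have hg' : ∀ y : Submonoid.powers x, IsUnit (g y) := fun y => hg y ▸ isUnit_one
  refine ⟨(IsLocalization.lift (M := Submonoid.powers x) (S := Localization (Submonoid.powers x)) hg').comp
    (algebraMap _ _), fun c => ?_⟩
  rw [RingHom.comp_apply, HomogeneousLocalization.algebraMap_apply, HomogeneousLocalization.val_mk,
    Localization.mk_eq_mk', IsLocalization.lift_mk'_spec, hg, one_mul]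

/-- A ring homomorphism out of the coordinate ring of a standard chart exists with any prescribed
values of the coordinate functions. -/
lemma exists_chart_hom {R : Type u} [CommRing R] (σ : k →+* R) (b : Fin (N + 1))
    (s : Fin (N + 1) → R) (hs : s b = 1) :
    ∃ f : Γ(ProjSpace k N, chart k N b) →+* R, (∀ c, f (toSections (str k N) _ c) = σ c) ∧
      ∀ l, f (coordSec b l) = s l := by
  let e := AlgebraicGeometry.Proj.basicOpenIsoAway
      (homogeneousSubmodule (Fin (N + 1)) k) (X b) (isHomogeneous_X k b) one_pos
  obtain ⟨g', hg'⟩ := exists_away_hom (eval₂Hom σ s) (X b) (by simp [hs])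
  have hf : ∀ (c : HomogeneousLocalization.NumDenSameDeg (homogeneousSubmodule (Fin (N + 1)) k)
      (Submonoid.powers (X b))) (s : Γ(ProjSpace k N, chart k N b)),
      ev _ (genPt_mem_chart b) s * algebraMap _ _ (c.den : FormRing k N) =
      algebraMap _ _ (c.num : FormRing k N) → e.inv.hom s = HomogeneousLocalization.mk c := by
    intro c s h
    have h1 : s = (AlgebraicGeometry.Proj.awayToSection
      (homogeneousSubmodule (Fin (N + 1)) k) (X b)).hom (HomogeneousLocalization.mk c) := by
      apply ev_injective _ (genPt_mem_chart b)
      have h2 := awayToSection_ev (X b) (genPt_mem_chart b) c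
      obtain ⟨n, hn⟩ := c.den_mem
      have hn' : X b ^ n = (c.den : FormRing k N) := hn
      exact mul_right_cancel₀ (algebraMap_frac_ne_zero (hn' ▸ pow_ne_zero _ (X_ne_zero b)))
        (h.trans h2.symm)
    exact (congrArg e.inv.hom h1).trans (CategoryTheory.Iso.hom_inv_id_apply e _)
  refine ⟨g'.comp e.inv.hom, fun c => ?_, fun l => ?_⟩
  · have h := hf ⟨0, ⟨C c, isHomogeneous_C _ _⟩, ⟨1, isHomogeneous_one _ _⟩, one_mem _⟩
      (toSections (str k N) _ c) (by rw [ev_toSections]; simp)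
    exact (congrArg g' h).trans ((hg' _).trans (by simp))
  · have h := hf ⟨1, ⟨X l, isHomogeneous_X k l⟩, ⟨X b, isHomogeneous_X k b⟩, ⟨1, pow_one _⟩⟩
      (coordSec b l) (ev_coordSec_mul b l)
    exact (congrArg g' h).trans ((hg' _).trans (by simp))

end ProjSpace

lemma AlgebraicGeometry.IsAffineOpen.exists_hom_appLE_eq {Z Y : Scheme.{u}} {U : Y.Opens}
    (hU : IsAffineOpen U) (α : Γ(Y, U) →+* Γ(Z, ⊤)) :
    ∃ (f : Z ⟶ Y) (h : ⊤ ≤ f ⁻¹ᵁ U), (f.appLE U ⊤ h).hom = α := by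
  let β : Γ(Y, U) ⟶ Γ(Z, ⊤) := CommRingCat.ofHom α
  have : IsAffine U.toScheme := hU
  let g : Z ⟶ U.toScheme := Z.toSpecΓ ≫ Spec.map (U.topIso.hom ≫ β) ≫ U.toScheme.isoSpec.inv
  have hg : g.appTop = U.topIso.hom ≫ β := by
    simp only [g, Scheme.Hom.comp_appTop, Scheme.toSpecΓ_appTop, Category.assoc]
    have h := congrArg Scheme.Hom.appTop (Scheme.toSpecΓ_isoSpec_inv U.toScheme)
    rw [Scheme.Hom.comp_appTop, Scheme.toSpecΓ_appTop, Scheme.Hom.id_appTop] at h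
    rw [Scheme.ΓSpecIso_naturality, reassoc_of% h]
  refine ⟨g ≫ U.ι, ?_, ?_⟩
  · intro z _
    exact (g z).2
  · have h : ⊤ ≤ U.ι ⁻¹ᵁ U := fun z _ => z.2
    have h1 : U.ι.appLE U ⊤ h ≫ U.topIso.hom = 𝟙 _ := by
      rw [Scheme.Opens.ι_appLE, Scheme.Opens.topIso_hom]
      exact (Y.presheaf.map_comp _ _).symm.trans (Y.presheaf.map_id _)
    suffices (g ≫ U.ι).appLE U ⊤ _ = β from congrArg CommRingCat.Hom.hom this
    refine (Scheme.Hom.appLE_comp_appLE g U.ι U ⊤ ⊤ h le_rfl).symm.trans ?_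
    have h2 : g.appLE ⊤ ⊤ le_rfl = g.appTop := Scheme.Hom.appLE_eq_app g
    rw [h2, hg, reassoc_of% h1]

namespace LineBundle

lemma appLE_toSections {k : Type u} [Field k] {X Y : Scheme.{u}} (f : X ⟶ Y)
    (sY : Y ⟶ Spec (CommRingCat.of k)) (U : Y.Opens) (V : X.Opens) (h : V ≤ f ⁻¹ᵁ U) (c : k) :
    (f.appLE U V h).hom (toSections sY U c) = toSections (f ≫ sY) V c :=
  (congrArg (sres X h) (app_toSections f sY U c)).trans (sres_toSections _ _ _)

end LineBundle

namespace ProjSpace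

open MvPolynomial ProjectiveSpectrum LineBundle

variable {k : Type u} [Field k] {N : ℕ}

/-- Local functions, one of which is `1`, are the coordinates of a morphism to projective space. -/
lemma exists_hom_of_coord {Z : Scheme.{u}} (sZ : Z ⟶ Spec (CommRingCat.of k)) (b : Fin (N + 1))
    (s : Fin (N + 1) → Γ(Z, ⊤)) (hs : s b = 1) :
    ∃ (f : Z ⟶ ProjSpace k N) (h : ⊤ ≤ f ⁻¹ᵁ chart k N b), f ≫ str k N = sZ ∧
      ∀ l, (f.appLE _ _ h).hom (coordSec b l) = s l := by
  obtain ⟨β, h1, h2⟩ := exists_chart_hom (toSections sZ ⊤) b s hs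
  obtain ⟨f, h, hf⟩ := IsAffineOpen.exists_hom_appLE_eq
    (Y := ProjSpace k N) (isAffineOpen_chart (k := k) b) β
  refine ⟨f, h, toSections_injective fun c => ?_, fun l => ?_⟩
  · rw [← appLE_toSections f (str k N) _ _ h]
    exact (DFunLike.congr_fun hf _).trans (h1 c)
  · exact (DFunLike.congr_fun hf _).trans (h2 l)

lemma basicOpen_coordSec_le (b l : Fin (N + 1)) :
    (ProjSpace k N).basicOpen (coordSec (k := k) b l) ≤ chart k N l := by
  intro x hx
  have hxb : x ∈ chart k N b := Scheme.basicOpen_le _ _ hx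
  obtain ⟨t, ht⟩ : IsUnit (sres (ProjSpace k N) (Scheme.basicOpen_le _ (coordSec (k := k) b l))
    (coordSec b l)) := RingedSpace.isUnit_res_basicOpen _ _
  have h1 := unitDeg_ev hx t
  rw [ht, ev_sres] at h1
  have h2 := h1.mul (UnitDeg.of_isHomogeneous (isHomogeneous_X k b) hxb)
  rw [ev_coordSec_mul] at h2
  exact h2.notMem

/-- Two morphisms to projective space with proportional coordinates are equal. -/
lemma hom_ext_of_coord {Z : Scheme.{u}} [IsIntegral Z] {f g : Z ⟶ ProjSpace k N}
    (hfg : f ≫ str k N = g ≫ str k N) {W : Z.Opens} (hW : genericPoint Z ∈ W) {i j : Fin (N + 1)}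
    (hf : W ≤ f ⁻¹ᵁ chart k N i) (hg : W ≤ g ⁻¹ᵁ chart k N j)
    (h : ∀ l, (f.appLE _ _ hf).hom (coordSec i l) =
      (f.appLE _ _ hf).hom (coordSec i j) * (g.appLE _ _ hg).hom (coordSec j l)) : f = g := by
  have hu : (f.appLE _ _ hf).hom (coordSec i j) * (g.appLE _ _ hg).hom (coordSec j i) = 1 := by
    rw [← h i, coordSec_self, map_one]
  have hle : W ≤ g ⁻¹ᵁ (ProjSpace k N).basicOpen (coordSec (k := k) j i) := by
    intro z hz
    rw [Scheme.preimage_basicOpen]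
    have h1 : IsUnit (sres Z hg ((g.app _).hom (coordSec j i))) :=
      IsUnit.of_mul_eq_one _ ((mul_comm _ _).trans hu)
    have h2 := Z.basicOpen_of_isUnit h1
    have h3 : Z.basicOpen (sres Z hg ((g.app _).hom (coordSec j i))) =
      W ⊓ Z.basicOpen ((g.app _).hom (coordSec j i)) := Scheme.basicOpen_res _ _ _
    exact ((h3.symm.trans h2).ge hz).2
  have hg' : W ≤ g ⁻¹ᵁ chart k N i :=
    hle.trans (preimage_mono g (basicOpen_coordSec_le j i))
  have hcoord : ∀ l, (g.appLE _ _ hg').hom (coordSec i l) * (g.appLE _ _ hg).hom (coordSec j i) =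
      (g.appLE _ _ hg).hom (coordSec j l) := by
    intro l
    have hij : genPt k N ∈ chart k N i ⊓ chart k N j := ⟨genPt_mem_chart i, genPt_mem_chart j⟩
    have h1 : sres _ (inf_le_left : chart k N i ⊓ chart k N j ≤ _) (coordSec i l) *
        sres _ (inf_le_right : chart k N i ⊓ chart k N j ≤ _) (coordSec j i) =
        sres _ (inf_le_right : chart k N i ⊓ chart k N j ≤ _) (coordSec j l) := by
      apply ev_injective _ hij
      rw [map_mul, ev_sres, ev_sres, ev_sres]
      apply mul_right_cancel₀ (algebraMap_frac_ne_zero (X_ne_zero j))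
      rw [mul_assoc, ev_coordSec_mul, ev_coordSec_mul, ev_coordSec_mul]
    have h2 := congrArg (g.appLE _ W (show W ≤ g ⁻¹ᵁ (chart k N i ⊓ chart k N j) from
      fun z hz => ⟨hg' hz, hg hz⟩)).hom h1
    rw [map_mul] at h2
    exact (congrArg₂ (· * ·) (appLE_sres g _ inf_le_left (coordSec i l)) (appLE_sres g _ inf_le_right
      (coordSec j i))).symm.trans (h2.trans (appLE_sres g _ inf_le_right (coordSec j l)))
  have happ : f.appLE _ _ hf = g.appLE _ _ hg' := by
    apply CommRingCat.hom_ext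
    apply chart_hom_ext
    · intro c
      rw [appLE_toSections, appLE_toSections, hfg]
    · intro l
      rw [h l, ← hcoord l]
      linear_combination ((g.appLE _ _ hg').hom (coordSec i l)) * hu
  have : IsAffine (chart k N i).toScheme := isAffineOpen_chart i
  have hres : f.resLE _ _ hf = g.resLE _ _ hg' := by
    apply ext_of_isAffine
    rw [Scheme.Hom.appTop, Scheme.Hom.appTop, Scheme.Hom.resLE_app_top, Scheme.Hom.resLE_app_top, happ]
  have : IsDominant W.ι := by
    constructor
    rw [DenseRange, Scheme.Opens.range_ι]
    exact W.2.dense ⟨_, hW⟩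
  apply ext_of_isDominant W.ι
  rw [← Scheme.Hom.resLE_comp_ι _ hf, ← Scheme.Hom.resLE_comp_ι _ hg', hres]

end ProjSpace

section

variable {X : Scheme.{u}} [IsIntegral X]

lemma mem_basicOpen_iff_unitAt {U : X.Opens} {x : X} (hx : x ∈ U) (s : Γ(X, U)) :
    x ∈ X.basicOpen s ↔ UnitAt x (gv U (generic_mem hx) s) := by
  constructor
  · intro h
    obtain ⟨t, ht⟩ : IsUnit (sres X (X.basicOpen_le s) s) := RingedSpace.isUnit_res_basicOpen _ _
    rw [← gv_sres (X.basicOpen_le s) (generic_mem h), ← ht]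
    exact unitAt_gv h t
  · rintro ⟨V, hV, t, ht⟩
    have h1 : sres X (inf_le_left : U ⊓ V ≤ U) s = sres X inf_le_right (t : Γ(X, V)) := by
      apply gv_injective _ (generic_mem (U := U ⊓ V) ⟨hx, hV⟩)
      rw [gv_sres, gv_sres, ht]
    have h2 : IsUnit (sres X (inf_le_left : U ⊓ V ≤ U) s) := h1 ▸ t.isUnit.map _
    have h3 := X.basicOpen_of_isUnit h2
    have h4 : X.basicOpen (sres X (inf_le_left : U ⊓ V ≤ U) s) = (U ⊓ V) ⊓ X.basicOpen s :=
      Scheme.basicOpen_res _ _ _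
    exact ((h4.symm.trans h3).ge ⟨hx, hV⟩).2

lemma genericPoint_mem_basicOpen_iff {U : X.Opens} (h : genericPoint X ∈ U) (s : Γ(X, U)) :
    genericPoint X ∈ X.basicOpen s ↔ gv U h s ≠ 0 :=
  (Scheme.mem_basicOpen X s _ h).trans isUnit_iff_ne_zero

end

namespace ProjSpace

open MvPolynomial ProjectiveSpectrum LineBundle

variable {k : Type u} [Field k] {N : ℕ}

lemma mem_basicOpen_iff_unitDeg {U : (ProjSpace k N).Opens} {x : FormSpec k N} (hx : x ∈ U)
    (s : Γ(ProjSpace k N, U)) :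
    x ∈ (ProjSpace k N).basicOpen s ↔ UnitDeg x 0 (ev U (genPt_mem hx) s) := by
  refine ⟨fun h => ?_, mem_basicOpen_of_unitDeg hx s⟩
  obtain ⟨t, ht⟩ : IsUnit (sres _ ((ProjSpace k N).basicOpen_le s) s) :=
    RingedSpace.isUnit_res_basicOpen _ _
  have := unitDeg_ev h t
  rwa [ht, ev_sres] at this

lemma mem_basicOpen_chartHom_iff {b : Fin (N + 1)} {x : FormSpec k N} (hx : x ∈ chart k N b)
    {F : FormRing k N} {n : ℕ} (hF : F.IsHomogeneous n) :
    x ∈ (ProjSpace k N).basicOpen (chartHom b F) ↔ F ∉ x.asHomogeneousIdeal := by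
  rw [mem_basicOpen_iff_unitDeg hx]
  have hb := (UnitDeg.of_isHomogeneous (isHomogeneous_X k b) hx).pow n
  have h1 := ev_chartHom_mul b hF
  constructor
  · intro h
    have := h.mul hb
    rw [h1] at this
    exact this.notMem
  · intro h
    have := (UnitDeg.of_isHomogeneous hF h).mul hb.inv
    rw [← h1, mul_inv_cancel_right₀ hb.ne_zero] at this
    simpa using this

variable {X : Scheme.{u}} [IsIntegral X] (f : X ⟶ ProjSpace k N) (b : Fin (N + 1))
  (hb : genericPoint X ∈ f ⁻¹ᵁ chart k N b)

/-- The value of a form at the generic point of `X`, in coordinates normalised by `X b = 1`. -/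
def formVal : FormRing k N →+* X.functionField :=
  (gv _ hb).comp ((f.app (chart k N b)).hom.comp (chartHom b))

lemma formVal_ne_zero_iff {F : FormRing k N} {n : ℕ} (hF : F.IsHomogeneous n) :
    formVal f b hb F ≠ 0 ↔
      F ∉ (show FormSpec k N from f (genericPoint X)).asHomogeneousIdeal := by
  refine (genericPoint_mem_basicOpen_iff hb ((f.app (chart k N b)).hom (chartHom b F))).symm.trans ?_
  rw [← mem_basicOpen_chartHom_iff (b := b) hb hF]
  exact (congrArg (genericPoint X ∈ ·) (Scheme.preimage_basicOpen f (chartHom b F)).symm).to_iff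

lemma formVal_X (l : Fin (N + 1)) :
    formVal f b hb (MvPolynomial.X l) = gv _ hb ((f.app _).hom (coordSec b l)) := by
  rw [formVal, RingHom.comp_apply, RingHom.comp_apply, chartHom, coe_eval₂Hom, eval₂_X]

lemma formVal_X_self : formVal f b hb (MvPolynomial.X b) = 1 := by
  rw [formVal_X, coordSec_self]
  exact (congrArg _ (map_one (f.app _).hom)).trans (map_one _)

/-- Proportional sections have proportional pullbacks. -/
lemma gv_app_mul_formVal {U : (ProjSpace k N).Opens} (hU : genericPoint X ∈ f ⁻¹ᵁ U)
    (s t : Γ(ProjSpace k N, U)) {F G : FormRing k N} {n : ℕ} (hF : F.IsHomogeneous n)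
    (hG : G.IsHomogeneous n) (h : ∀ h, ev U h s * algebraMap _ _ G = ev U h t * algebraMap _ _ F) :
    gv _ hU ((f.app U).hom s) * formVal f b hb G = gv _ hU ((f.app U).hom t) * formVal f b hb F := by
  have hV : genPt k N ∈ U ⊓ chart k N b := genPt_mem (x := f (genericPoint X)) ⟨hU, hb⟩
  have h1 : sres _ (inf_le_left : U ⊓ chart k N b ≤ _) s * sres _ inf_le_right (chartHom b G) =
      sres _ (inf_le_left : U ⊓ chart k N b ≤ _) t * sres _ inf_le_right (chartHom b F) := by
    apply ev_injective _ hV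
    rw [map_mul, map_mul, ev_sres, ev_sres, ev_sres, ev_sres]
    apply mul_right_cancel₀ (pow_ne_zero n (algebraMap_frac_ne_zero (X_ne_zero b)))
    rw [mul_assoc, mul_assoc, ev_chartHom_mul b hF, ev_chartHom_mul b hG, h]
  have hW : f ⁻¹ᵁ U ⊓ f ⁻¹ᵁ chart k N b ≤ f ⁻¹ᵁ (U ⊓ chart k N b) := fun _ h => h
  have key : ∀ (a : Γ(ProjSpace k N, U)) (H : FormRing k N),
      gv (f ⁻¹ᵁ U ⊓ f ⁻¹ᵁ chart k N b) ⟨hU, hb⟩ ((f.appLE _ _ hW).hom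
        (sres _ inf_le_left a * sres _ inf_le_right (chartHom b H))) =
      gv _ hU ((f.app U).hom a) * formVal f b hb H := by
    intro a H
    rw [map_mul, map_mul]
    have e1 := appLE_sres f hW inf_le_left a
    have e2 := appLE_sres f hW inf_le_right (chartHom b H)
    refine congrArg₂ (· * ·) ((congrArg _ e1).trans ?_) ((congrArg _ e2).trans ?_)
    · exact gv_sres inf_le_left _ ((f.app U).hom a)
    · exact gv_sres inf_le_right _ ((f.app _).hom (chartHom b H))
  rw [← key, ← key, h1]

end ProjSpace

section

open LineBundle

variable {X : Scheme.{u}} [IsIntegral X] {M : LineBundle X} {w : M.ι → X.functionField}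

/-- A global section in a generic trivialisation. -/
lemma IsGenFrame.exists_gv (hw : IsGenFrame M w) (σ : GlobalSec M) :
    ∃ g, ∀ i h, gv (M.U i) h (σ.s i) = g * w i := by
  obtain ⟨i₀, hi₀⟩ := ProjSpace.exists_mem_U M (genericPoint X)
  refine ⟨gv (M.U i₀) hi₀ (σ.s i₀) / w i₀, fun i h => ?_⟩
  have h1 : genericPoint X ∈ M.U i ⊓ M.U i₀ := ⟨h, hi₀⟩
  have h2 := congrArg (gv _ h1) (σ.compat i i₀)
  rw [map_mul, gv_sres, gv_sres] at h2
  rw [h2, ← hw.trans i i₀ h1, mul_comm (_ / _), mul_assoc, mul_div_cancel₀ _ (hw.ne_zero i₀)]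

lemma IsGenFrame.exists_section (hw : IsGenFrame M w) (g : X.functionField)
    (hg : ∀ i, ∀ x ∈ M.U i, RegAt x (g * w i)) :
    ∃ σ : GlobalSec M, ∀ i h, gv (M.U i) h (σ.s i) = g * w i := by
  have : ∀ i, ∃ s : Γ(X, M.U i), ∀ h, gv (M.U i) h s = g * w i := by
    intro i
    by_cases h : genericPoint X ∈ M.U i
    · obtain ⟨s, hs⟩ := exists_gv_eq (M.U i) h _ (hg i)
      exact ⟨s, fun _ => hs⟩
    · exact ⟨0, fun h' => absurd h' h⟩
  choose s hs using this
  refine ⟨⟨s, fun i j => ?_⟩, hs⟩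
  by_cases h : genericPoint X ∈ M.U i ⊓ M.U j
  · apply gv_injective _ h
    rw [map_mul, gv_sres, gv_sres, hs, hs, ← hw.trans i j h]
    ring
  · exact TopCat.Presheaf.section_ext X.sheaf _ _ _ fun x hx => absurd (generic_mem hx) h

lemma IsGenFrame.pullbackLB_pow {Y : Scheme.{u}} {f : X ⟶ Y} {O : LineBundle Y}
    {w : O.ι → X.functionField} (hw : IsGenFrame (pullbackLB f O) w) (n : ℕ) :
    IsGenFrame (pullbackLB f (O.pow n)) (fun i => w i ^ n) where
  ne_zero i := pow_ne_zero _ (hw.ne_zero i)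
  trans i j h := by
    rw [← (hw.pow n).trans i j h]
    congr 3
    exact map_pow (Units.map (f.appLE (O.U i ⊓ O.U j) (f ⁻¹ᵁ O.U i ⊓ f ⁻¹ᵁ O.U j)
      (preimage_inf f (O.U i) (O.U j)).ge).hom.toMonoidHom) (O.t i j) n

lemma mem_basicOpen_pullback {X Y : Scheme.{u}} (f : X ⟶ Y) {U : Y.Opens} (s : Γ(Y, U)) (x : X) :
    x ∈ X.basicOpen ((f.app U).hom s) ↔ f x ∈ Y.basicOpen s :=
  (congrArg (x ∈ ·) (Scheme.preimage_basicOpen f s).symm).to_iff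

end

namespace ProjSpace

open MvPolynomial ProjectiveSpectrum LineBundle

variable {k : Type u} [Field k] {N : ℕ} {X : Scheme.{u}} [IsIntegral X]

/-- A polarised endomorphism of a projectively normal variety is given by forms. -/
lemma exists_lift_forms (hN : 1 ≤ N) {O1 : LineBundle (ProjSpace k N)}
    (hO1 : IsTautologicalBundle k N O1) (φ : X ⟶ X) (ι : X ⟶ ProjSpace k N)
    {L : LineBundle X} {d : ℕ} (hpull : (LineBundle.pullbackLB φ L).EquivLB (L.pow d))
    (hind : (LineBundle.pullbackLB ι O1).EquivLB L)
    (hsurj : Function.Surjective (fun σ : GlobalSec (O1.pow d) => pullbackSec ι (O1.pow d) σ)) :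
    ∃ F : Fin (N + 1) → FormRing k N, (∀ l, (F l).IsHomogeneous d) ∧
      (∀ x : X, ∃ l, F l ∉ (show FormSpec k N from ι x).asHomogeneousIdeal) ∧
      ∀ a ha b hb l, formVal ι a ha (F l) =
        formVal ι a ha (F b) * formVal (φ ≫ ι) b hb (MvPolynomial.X l) := by
  obtain ⟨u, hu⟩ := exists_isFrame_one hN hO1
  obtain ⟨w, hw⟩ := exists_isGenFrame (LineBundle.pullbackLB ι O1)
  obtain ⟨z, hz⟩ := exists_isGenFrame (LineBundle.pullbackLB φ (LineBundle.pullbackLB ι O1))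
  obtain ⟨h, h0, hrel⟩ : ∃ h ≠ 0, FrameRel (LineBundle.pullbackLB φ (LineBundle.pullbackLB ι O1)) z
      ((LineBundle.pullbackLB ι O1).pow d) (fun i => w i ^ d) h := by
    obtain ⟨e, he⟩ := exists_isGenFrame L
    obtain ⟨e', he'⟩ := exists_isGenFrame (LineBundle.pullbackLB φ L)
    obtain ⟨h1, h10, r1⟩ := (hind.pullbackLB φ).exists_frameRel hz he'
    obtain ⟨h2, h20, r2⟩ := hpull.exists_frameRel he' (he.pow d)
    obtain ⟨h3, h30, r3⟩ := hind.exists_frameRel hw he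
    exact ⟨_, mul_ne_zero h10 (mul_ne_zero h20 (inv_ne_zero (pow_ne_zero d h30))),
      r1.trans (r2.trans (r3.pow d).symm)⟩
  choose σ hσ using fun l : Fin (N + 1) =>
    hu.exists_section (n := 1) Nat.cast_one (isHomogeneous_X k l)
  choose Z hZ using fun l => hz.exists_gv (pullbackSec φ _ (pullbackSec ι _ (σ l)))
  choose t ht using fun l => (hw.pullbackLB_pow d).exists_section (Z l * h) fun i x hx => by
    obtain ⟨j, hj⟩ := exists_mem_U (LineBundle.pullbackLB φ (LineBundle.pullbackLB ι O1)) x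
    have h1 := (regAt_gv hj ((pullbackSec φ _ (pullbackSec ι _ (σ l))).s j)).mul
      (hrel x j i hj hx).inv.regAt
    rw [hZ] at h1
    convert h1 using 1
    have := hz.ne_zero j
    field_simp
  choose τ hτ using fun l => hsurj (t l)
  have hτ' : ∀ l i (hi : genericPoint X ∈ ι ⁻¹ᵁ O1.U i),
      gv _ hi ((ι.app (O1.U i)).hom ((τ l).s i)) = Z l * h * w i ^ d := fun l i hi =>
    (congrArg (fun s : GlobalSec (LineBundle.pullbackLB ι (O1.pow d)) => gv _ hi (s.s i))
      (hτ l)).trans (ht l i hi)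
  have hF : ∀ l, ∃ F : FormRing k N, F.IsHomogeneous d ∧
      ∀ i h, ev (O1.U i) h ((τ l).s i) = algebraMap _ _ F * u i ^ d := by
    intro l
    obtain ⟨g, hg, rfl | ⟨n, F, hn, hF, rfl⟩⟩ := (hu.pow d).exists_form hN _ (τ l).compat
    · refine ⟨0, isHomogeneous_zero _ _ _, fun i h => ?_⟩
      rw [map_zero]
      exact hg i h
    · obtain rfl : n = d := by simpa using hn
      exact ⟨F, hF, hg⟩
  choose F hFd hF using hF
  have hZunit : ∀ (x : X) l (j : O1.ι), ι (φ x) ∈ O1.U j →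
      MvPolynomial.X l ∉ (show FormSpec k N from ι (φ x)).asHomogeneousIdeal →
      UnitAt x (Z l * z j) := by
    intro x l j hj hl
    have hj' : x ∈ φ ⁻¹ᵁ (ι ⁻¹ᵁ O1.U j) := hj
    have h1 : (show FormSpec k N from ι (φ x)) ∈ (ProjSpace k N).basicOpen ((σ l).s j) := by
      refine (mem_basicOpen_iff_unitDeg hj _).2 ?_
      rw [hσ]
      have := (UnitDeg.of_isHomogeneous (isHomogeneous_X k l) hl).mul (hu.unitDeg j _ hj)
      simpa using this
    have h2 : x ∈ X.basicOpen ((φ.app _).hom ((ι.app _).hom ((σ l).s j))) :=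
      (mem_basicOpen_pullback φ _ x).2 ((mem_basicOpen_pullback ι _ _).2 h1)
    have h3 := (mem_basicOpen_iff_unitAt hj' _).1 h2
    rwa [← hZ l j (generic_mem hj')]
  refine ⟨F, hFd, fun x => ?_, fun a ha b hb l => ?_⟩
  · obtain ⟨l, hl⟩ := exists_mem_chart (show FormSpec k N from ι (φ x))
    obtain ⟨j, hj⟩ := exists_mem_U O1 (ι (φ x))
    obtain ⟨i, hi⟩ := exists_mem_U O1 (ι x)
    refine ⟨l, ?_⟩
    have hi' : x ∈ ι ⁻¹ᵁ O1.U i := hi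
    have h1 := (hZunit x l j hj hl).mul (hrel x j i hj hi).inv
    have h2 : UnitAt x (gv _ (generic_mem hi') ((ι.app (O1.U i)).hom ((τ l).s i))) := by
      rw [hτ']
      convert h1 using 1
      have := hz.ne_zero j
      field_simp
    have h3 := (mem_basicOpen_pullback ι _ x).1 ((mem_basicOpen_iff_unitAt hi' _).2 h2)
    have h4 := (mem_basicOpen_iff_unitDeg hi _).1 h3
    rw [hF] at h4
    have h5 := h4.mul ((hu.unitDeg i _ hi).inv.pow d)
    rw [inv_pow, mul_inv_cancel_right₀ (pow_ne_zero d (hu.unitDeg i _ hi).ne_zero)] at h5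
    exact h5.notMem
  · have hZb : Z b ≠ 0 := by
      obtain ⟨j, hj⟩ := exists_mem_U O1 (ι (φ (genericPoint X)))
      exact left_ne_zero_of_mul (hZunit _ b j hj hb).ne_zero
    have e1 : Z l = Z b * formVal (φ ≫ ι) b hb (MvPolynomial.X l) := by
      obtain ⟨j, hj⟩ := exists_mem_U O1 (ι (φ (genericPoint X)))
      have h1 := gv_app_mul_formVal (φ ≫ ι) b hb (U := O1.U j) hj ((σ l).s j) ((σ b).s j)
        (isHomogeneous_X k l) (isHomogeneous_X k b) fun h => by
          rw [hσ, hσ]; ring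
      rw [formVal_X_self, mul_one] at h1
      have h2 : ∀ l, gv _ hj (((φ ≫ ι).app (O1.U j)).hom ((σ l).s j)) = Z l * z j :=
        fun l => hZ l j hj
      rw [h2, h2] at h1
      apply mul_right_cancel₀ (hz.ne_zero j)
      rw [h1]; ring
    obtain ⟨i, hi⟩ := exists_mem_U O1 (ι (genericPoint X))
    have h1 := gv_app_mul_formVal ι a ha (U := O1.U i) hi ((τ l).s i) ((τ b).s i)
      (hFd l) (hFd b) fun h => by
        rw [hF, hF]; ring
    replace h1 := (congrArg (· * _) (hτ' l i hi)).symm.trans (h1.trans (congrArg (· * _) (hτ' b i hi)))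
    apply mul_left_cancel₀ (mul_ne_zero hZb (mul_ne_zero h0 (pow_ne_zero d (hw.ne_zero i))))
    rw [e1] at h1
    linear_combination -h1

end ProjSpace

namespace ProjSpace

open MvPolynomial ProjectiveSpectrum

variable {k : Type u} [Field k] {N : ℕ}

/-- Forms without common zeros on a closed set cut out by forms of degree at most `d` are
congruent, on this set, to forms without common zeros. -/
lemma exists_forms_without_zeros [Infinite k] {T : Set (FormSpec k N)} {d : ℕ}
    (hT : T = zeroLocus (homogeneousSubmodule (Fin (N + 1)) k) {f : FormRing k N |
      (∃ e : ℕ, e ≤ d ∧ f ∈ homogeneousSubmodule (Fin (N + 1)) k e) ∧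
        ∀ x ∈ T, f ∈ x.asHomogeneousIdeal})
    {F : Fin (N + 1) → FormRing k N}
    (hFT : ∀ x ∈ T, ∃ l, F l ∉ x.asHomogeneousIdeal) :
    ∃ h : Fin (N + 1) → FormRing k N, (∀ l, (h l).IsHomogeneous d) ∧
      (∀ l, ∀ x ∈ T, h l ∈ x.asHomogeneousIdeal) ∧
      ∀ y : FormSpec k N, ∃ l, F l + h l ∉ y.asHomogeneousIdeal := by
  let W : Submodule k (FormRing k N) := homogeneousSubmodule (Fin (N + 1)) k d ⊓
    ⨅ x ∈ T, (ProjectiveSpectrum.asHomogeneousIdeal x).toIdeal.restrictScalars k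
  have hW : ∀ f, f ∈ W ↔ f.IsHomogeneous d ∧ ∀ x ∈ T, f ∈ x.asHomogeneousIdeal := by
    intro f
    simp only [W, Submodule.mem_inf, Submodule.mem_iInf]
    rfl
  obtain ⟨h, hhW, hh⟩ := exists_add_forms W F
  refine ⟨h, fun l => ((hW _).1 (hhW l)).1, fun l => ((hW _).1 (hhW l)).2, fun y => ?_⟩
  by_contra! hy
  have hlt : y.asHomogeneousIdeal.toIdeal < Ideal.span (Set.range X) := by
    refine lt_of_le_of_ne (fun f hf => mem_span_range_X ?_) fun he => ?_
    · by_contra hf'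
      have h1 : ((DirectSum.decompose (homogeneousSubmodule (Fin (N + 1)) k) f 0 :
          homogeneousSubmodule (Fin (N + 1)) k 0) : FormRing k N) ∈ y.asHomogeneousIdeal :=
        y.asHomogeneousIdeal.isHomogeneous 0 hf
      have h2 : ((DirectSum.decompose (homogeneousSubmodule (Fin (N + 1)) k) f 0 :
          homogeneousSubmodule (Fin (N + 1)) k 0) : FormRing k N) = C (coeff 0 f) :=
        (MvPolynomial.decomposition.decompose'_apply f 0).trans (homogeneousComponent_zero f)
      rw [h2] at h1
      exact y.isPrime.ne_top (Ideal.eq_top_of_isUnit_mem _ h1 ((isUnit_iff_ne_zero.2 hf').map C))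
    · obtain ⟨i, hi⟩ := exists_mem_chart y
      exact hi (he.ge (Ideal.subset_span ⟨i, rfl⟩))
  have hWy := hh _ y.isPrime hy hlt
  have hyT : y ∈ T := by
    rw [hT]
    rintro f ⟨⟨e, hed, hfe⟩, hfT⟩
    obtain ⟨i, hi⟩ := exists_mem_chart y
    have h1 : X i ^ (d - e) * f ∈ W := by
      refine (hW _).2 ⟨?_, fun x hx => Ideal.mul_mem_left _ _ (hfT x hx)⟩
      have := ((isHomogeneous_X k i).pow (d - e)).mul hfe
      rwa [one_mul, Nat.sub_add_cancel hed] at this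
    exact (y.isPrime.mem_or_mem (hWy h1)).resolve_left fun h => hi (y.isPrime.mem_of_pow_mem _ h)
  obtain ⟨l, hl⟩ := hFT y hyT
  refine hl ?_
  have := y.asHomogeneousIdeal.toIdeal.sub_mem (hy l) (((hW _).1 (hhW l)).2 y hyT)
  rwa [add_sub_cancel_right] at this

end ProjSpace

lemma AlgebraicGeometry.Scheme.exists_hom_of_isOpenCover {X Y : Scheme.{u}} {κ : Type}
    (U : κ → X.Opens) (hU : TopologicalSpace.IsOpenCover U) (f : ∀ i, (U i).toScheme ⟶ Y)
    (hf : ∀ i j, X.homOfLE (inf_le_left : U i ⊓ U j ≤ U i) ≫ f i =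
      X.homOfLE (inf_le_right : U i ⊓ U j ≤ U j) ≫ f j) :
    ∃ g : X ⟶ Y, ∀ i, (U i).ι ≫ g = f i := by
  let 𝒰 := X.openCoverOfIsOpenCover U hU
  refine ⟨𝒰.glueMorphisms f ?_, fun i => 𝒰.ι_glueMorphisms f _ i⟩
  intro i j
  have h := isPullback_opens_inf (U i) (U j)
  refine (cancel_epi h.isoPullback.hom).1 ?_
  refine (h.isoPullback_hom_fst_assoc (f i)).trans ((hf i j).trans ?_)
  exact (h.isoPullback_hom_snd_assoc (f j)).symm

lemma AlgebraicGeometry.Scheme.hom_ext_of_isOpenCover {X Y : Scheme.{u}} {κ : Type}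
    (U : κ → X.Opens) (hU : TopologicalSpace.IsOpenCover U) {f g : X ⟶ Y}
    (h : ∀ i, (U i).ι ≫ f = (U i).ι ≫ g) : f = g :=
  (X.openCoverOfIsOpenCover U hU).hom_ext _ _ h

lemma LineBundle.homOfLE_comp_appLE {X Y : Scheme.{u}} {U V : X.Opens} (hV : V ≤ U)
    (f : U.toScheme ⟶ Y) {W : Y.Opens} (h : ⊤ ≤ f ⁻¹ᵁ W) (h' : ⊤ ≤ (X.homOfLE hV ≫ f) ⁻¹ᵁ W)
    (a : Γ(Y, W)) {s : Γ(X, U)} (ha : (f.appLE W ⊤ h).hom a = U.topIso.inv.hom s) :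
    (((X.homOfLE hV ≫ f).appLE W ⊤ h').hom a) = V.topIso.inv.hom (sres X hV s) := by
  have h0 : ⊤ ≤ X.homOfLE hV ⁻¹ᵁ ⊤ := fun _ _ => _root_.trivial
  have h1 := Scheme.Hom.appLE_comp_appLE (X.homOfLE hV) f W ⊤ ⊤ h h0
  have h2 := congrArg (fun g => g.hom a) h1
  refine h2.symm.trans ?_
  refine (congrArg (((X.homOfLE hV).appLE ⊤ ⊤ h0).hom) ha).trans ?_
  suffices U.topIso.inv ≫ (X.homOfLE hV).appLE ⊤ ⊤ h0 =
    X.presheaf.map (homOfLE hV).op ≫ V.topIso.inv from congrArg (fun g => g.hom s) this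
  rw [Scheme.homOfLE_appLE, Scheme.Opens.topIso_inv, Scheme.Opens.topIso_inv]
  refine (X.presheaf.map_comp _ _).symm.trans (Eq.trans ?_ (X.presheaf.map_comp (homOfLE hV).op
    (eqToHom V.ι_image_top).op))
  exact congrArg X.presheaf.map (Subsingleton.elim _ _)

lemma LineBundle.exists_appLE_of_ι_comp_eq {X Y : Scheme.{u}} {U : X.Opens} {ψ : X ⟶ Y}
    {f : U.toScheme ⟶ Y} (hψ : U.ι ≫ ψ = f) {W : Y.Opens} (h : ⊤ ≤ f ⁻¹ᵁ W) :
    ∃ h' : U ≤ ψ ⁻¹ᵁ W, ∀ (a : Γ(Y, W)) {s : Γ(X, U)},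
      (f.appLE W ⊤ h).hom a = U.topIso.inv.hom s → (ψ.appLE W U h').hom a = s := by
  subst hψ
  have h' : U ≤ ψ ⁻¹ᵁ W := fun x hx => h (x := ⟨x, hx⟩) _root_.trivial
  refine ⟨h', fun a s hs => ?_⟩
  have h0 : ⊤ ≤ U.ι ⁻¹ᵁ U := fun z _ => z.2
  have h1 : U.ι.appLE U ⊤ h0 ≫ U.topIso.hom = 𝟙 _ := by
    rw [Scheme.Opens.ι_appLE, Scheme.Opens.topIso_hom]
    exact (X.presheaf.map_comp _ _).symm.trans (X.presheaf.map_id _)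
  have h2 := Scheme.Hom.appLE_comp_appLE U.ι ψ W U ⊤ h' h0
  have h3 : ψ.appLE W U h' = (U.ι ≫ ψ).appLE W ⊤ h ≫ U.topIso.hom := by
    rw [← h2, Category.assoc, h1, Category.comp_id]
  have h4 := congrArg (fun g => g.hom a) h3
  refine h4.trans ((congrArg U.topIso.hom.hom hs).trans ?_)
  exact congrArg (fun g => g.hom s) U.topIso.inv_hom_id

namespace ProjSpace

open MvPolynomial ProjectiveSpectrum LineBundle

variable {k : Type u} [Field k] {N : ℕ}

/-- Two morphisms with proportional coordinates on overlapping open subsets agree on the overlap. -/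
lemma homOfLE_comp_eq_of_coord {U V : (ProjSpace k N).Opens} (hU : genPt k N ∈ U)
    (hV : genPt k N ∈ V) {G : Fin (N + 1) → FormRing k N} {i j : Fin (N + 1)} (hi : G i ≠ 0)
    (hj : G j ≠ 0) {s : Fin (N + 1) → Γ(ProjSpace k N, U)} {t : Fin (N + 1) → Γ(ProjSpace k N, V)}
    (hs : ∀ l, ev U hU (s l) * algebraMap _ _ (G i) = algebraMap _ _ (G l))
    (ht : ∀ l, ev V hV (t l) * algebraMap _ _ (G j) = algebraMap _ _ (G l))
    {f : U.toScheme ⟶ ProjSpace k N} {g : V.toScheme ⟶ ProjSpace k N}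
    (hf : f ≫ str k N = U.ι ≫ str k N) (hg : g ≫ str k N = V.ι ≫ str k N)
    (hfU : ⊤ ≤ f ⁻¹ᵁ chart k N i) (hgV : ⊤ ≤ g ⁻¹ᵁ chart k N j)
    (hfs : ∀ l, (f.appLE _ _ hfU).hom (coordSec i l) = U.topIso.inv.hom (s l))
    (hgt : ∀ l, (g.appLE _ _ hgV).hom (coordSec j l) = V.topIso.inv.hom (t l)) :
    (ProjSpace k N).homOfLE (inf_le_left : U ⊓ V ≤ U) ≫ f =
      (ProjSpace k N).homOfLE (inf_le_right : U ⊓ V ≤ V) ≫ g := by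
  have hx : genPt k N ∈ U ⊓ V := ⟨hU, hV⟩
  have : Nonempty (U ⊓ V : (ProjSpace k N).Opens).toScheme := ⟨⟨_, hx⟩⟩
  have : IsIntegral (U ⊓ V : (ProjSpace k N).Opens).toScheme :=
    isIntegral_of_isOpenImmersion (U ⊓ V).ι
  have h1 : ⊤ ≤ ((ProjSpace k N).homOfLE (inf_le_left : U ⊓ V ≤ U) ≫ f) ⁻¹ᵁ chart k N i :=
    fun z _ => hfU _root_.trivial
  have h2 : ⊤ ≤ ((ProjSpace k N).homOfLE (inf_le_right : U ⊓ V ≤ V) ≫ g) ⁻¹ᵁ chart k N j :=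
    fun z _ => hgV _root_.trivial
  refine hom_ext_of_coord (W := ⊤) ?_ _root_.trivial h1 h2 fun l => ?_
  · rw [Category.assoc, Category.assoc, hf, hg, Scheme.homOfLE_ι_assoc, Scheme.homOfLE_ι_assoc]
  · have key : sres _ inf_le_left (s l) = sres _ (inf_le_left : U ⊓ V ≤ U) (s j) *
        sres _ (inf_le_right : U ⊓ V ≤ V) (t l) := by
      apply ev_injective _ hx
      rw [map_mul, ev_sres, ev_sres, ev_sres]
      apply mul_right_cancel₀ (algebraMap_frac_ne_zero hi)
      apply mul_right_cancel₀ (algebraMap_frac_ne_zero hj)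
      linear_combination (algebraMap _ (FormFrac k N) (G j)) * (hs l) -
        (algebraMap _ (FormFrac k N) (G j)) * ev _ hV (t l) * (hs j) -
        (algebraMap _ (FormFrac k N) (G j)) * (ht l)
    refine (homOfLE_comp_appLE inf_le_left f hfU h1 _ (hfs l)).trans (Eq.trans ?_
      (congrArg₂ (· * ·) (homOfLE_comp_appLE inf_le_left f hfU h1 _ (hfs j))
        (homOfLE_comp_appLE inf_le_right g hgV h2 _ (hgt l))).symm)
    exact (congrArg _ key).trans (map_mul _ _ _)

/-- Forms `G l` of the same degree, without common zeros, define a morphism between projective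
spaces. -/
lemma exists_hom_of_forms {d : ℕ} {G : Fin (N + 1) → FormRing k N}
    (hG : ∀ l, (G l).IsHomogeneous d) (hG0 : ∀ y : FormSpec k N, ∃ l, G l ∉ y.asHomogeneousIdeal) :
    ∃ ψ : ProjSpace k N ⟶ ProjSpace k N, ψ ≫ str k N = str k N ∧
      ∀ i, G i ≠ 0 → ∃ h : Proj.basicOpen (homogeneousSubmodule (Fin (N + 1)) k) (G i) ≤
        ψ ⁻¹ᵁ chart k N i, ∀ l hx, ev _ hx ((ψ.appLE _ _ h).hom (coordSec i l)) *
          algebraMap _ _ (G i) = algebraMap _ _ (G l) := by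
  let κ := {i : Fin (N + 1) // G i ≠ 0}
  let U : κ → (ProjSpace k N).Opens := fun i =>
    Proj.basicOpen (homogeneousSubmodule (Fin (N + 1)) k) (G i)
  have hUgen : ∀ i, genPt k N ∈ U i := fun i => notMem_genPt i.2
  have hU : TopologicalSpace.IsOpenCover U := by
    refine TopologicalSpace.IsOpenCover.mk (top_unique fun y _ => ?_)
    obtain ⟨l, hl⟩ := hG0 y
    exact TopologicalSpace.Opens.mem_iSup.2 ⟨⟨l, ne_zero_of_notMem hl⟩, hl⟩
  have hs : ∀ (i : κ) l, ∃ s : Γ(ProjSpace k N, U i),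
      ev _ (hUgen i) s * algebraMap _ _ (G i) = algebraMap _ _ (G l) := by
    intro i l
    obtain ⟨s, hs⟩ := exists_ev_eq (U i) (hUgen i)
      (algebraMap _ (FormFrac k N) (G l) * (algebraMap _ (FormFrac k N) (G i))⁻¹) fun x hx => by
        have := (RegDeg.of_isHomogeneous (hG l) x).mul
          (UnitDeg.of_isHomogeneous (hG i) hx).inv.regDeg
        simpa using this
    exact ⟨s, by rw [hs, inv_mul_cancel_right₀ (algebraMap_frac_ne_zero i.2)]⟩
  choose s hs using hs
  have hss : ∀ i, s i i = 1 := by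
    intro i
    apply ev_injective _ (hUgen i)
    apply mul_right_cancel₀ (algebraMap_frac_ne_zero i.2)
    rw [hs, map_one, one_mul]
  have hf := fun i : κ => exists_hom_of_coord (k := k) ((U i).ι ≫ str k N) i.1
    (fun l => (U i).topIso.inv.hom (s i l)) (by rw [hss, map_one])
  choose f hfle hfstr hfs using hf
  obtain ⟨ψ, hψ⟩ := Scheme.exists_hom_of_isOpenCover U hU f fun i j =>
    homOfLE_comp_eq_of_coord (hUgen i) (hUgen j) i.2 j.2 (hs i) (hs j) (hfstr i) (hfstr j)
      (hfle i) (hfle j) (hfs i) (hfs j)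
  refine ⟨ψ, ?_, ?_⟩
  · refine Scheme.hom_ext_of_isOpenCover U hU fun i => ?_
    rw [← Category.assoc, hψ, hfstr]
  · intro i hi
    obtain ⟨h, hl⟩ := exists_appLE_of_ι_comp_eq (hψ ⟨i, hi⟩) (hfle ⟨i, hi⟩)
    refine ⟨h, fun l hx => ?_⟩
    rw [hl _ (hfs ⟨i, hi⟩ l)]
    exact hs ⟨i, hi⟩ l

end ProjSpace

namespace ProjSpace

open MvPolynomial ProjectiveSpectrum LineBundle

variable {k : Type u} [Field k] {N : ℕ} {X : Scheme.{u}} [IsIntegral X]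

lemma eq_comp_of_formVal {d : ℕ} {G : Fin (N + 1) → FormRing k N}
    (hG : ∀ l, (G l).IsHomogeneous d) {ψ : ProjSpace k N ⟶ ProjSpace k N}
    (hψ : ψ ≫ str k N = str k N)
    (hψG : ∀ i, G i ≠ 0 → ∃ h : Proj.basicOpen (homogeneousSubmodule (Fin (N + 1)) k) (G i) ≤
      ψ ⁻¹ᵁ chart k N i, ∀ l hx, ev _ hx ((ψ.appLE _ _ h).hom (coordSec i l)) *
        algebraMap _ _ (G i) = algebraMap _ _ (G l))
    {g ι : X ⟶ ProjSpace k N} (hgι : g ≫ str k N = ι ≫ str k N) {a b : Fin (N + 1)}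
    (ha : genericPoint X ∈ ι ⁻¹ᵁ chart k N a) (hb : genericPoint X ∈ g ⁻¹ᵁ chart k N b)
    (hG0 : ∃ i, formVal ι a ha (G i) ≠ 0)
    (h : ∀ l, formVal ι a ha (G l) = formVal ι a ha (G b) * formVal g b hb (MvPolynomial.X l)) :
    g = ι ≫ ψ := by
  obtain ⟨i, hi⟩ := hG0
  obtain ⟨hle, hs⟩ := hψG i fun h0 => hi (by rw [h0, map_zero])
  have hU : genericPoint X ∈ ι ⁻¹ᵁ Proj.basicOpen (homogeneousSubmodule (Fin (N + 1)) k) (G i) :=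
    (formVal_ne_zero_iff ι a ha (hG i)).1 hi
  have hW : genericPoint X ∈ g ⁻¹ᵁ chart k N b ⊓
    ι ⁻¹ᵁ Proj.basicOpen (homogeneousSubmodule (Fin (N + 1)) k) (G i) := ⟨hb, hU⟩
  have hWψ : g ⁻¹ᵁ chart k N b ⊓ ι ⁻¹ᵁ Proj.basicOpen (homogeneousSubmodule (Fin (N + 1)) k) (G i) ≤
    (ι ≫ ψ) ⁻¹ᵁ chart k N i := fun x hx => hle hx.2
  have e1 : ∀ l, gv _ hW ((g.appLE _ _ inf_le_left).hom (coordSec b l)) =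
      formVal g b hb (MvPolynomial.X l) := by
    intro l
    rw [formVal_X]
    exact gv_sres inf_le_left hW ((g.app _).hom (coordSec b l))
  have e2 : ∀ l, gv _ hW (((ι ≫ ψ).appLE _ _ hWψ).hom (coordSec i l)) * formVal ι a ha (G i) =
      formVal ι a ha (G l) := by
    intro l
    have h1 := gv_app_mul_formVal ι a ha hU ((ψ.appLE _ _ hle).hom (coordSec i l)) 1 (hG l) (hG i)
      fun hx => by rw [hs, map_one, one_mul]
    rw [map_one] at h1
    refine (congrArg (· * _) ?_).trans (h1.trans (by rw [map_one, one_mul]))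
    have h2 := Scheme.Hom.appLE_comp_appLE ι ψ (chart k N i) _ _ hle
      (inf_le_right : g ⁻¹ᵁ chart k N b ⊓ _ ≤ _)
    refine (congrArg (fun r => gv _ hW (r.hom (coordSec i l))) h2).symm.trans ?_
    exact gv_sres inf_le_right hW ((ι.app _).hom ((ψ.appLE _ _ hle).hom (coordSec i l)))
  refine hom_ext_of_coord (by rw [Category.assoc, hψ, hgι]) hW inf_le_left hWψ fun l => ?_
  apply gv_injective _ hW
  refine Eq.trans ?_ (map_mul _ _ _).symm
  refine (e1 l).trans (Eq.trans ?_ (congrArg (· * _) (e1 i)).symm)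
  have hb0 : formVal ι a ha (G b) ≠ 0 := fun h0 => hi (by rw [h, h0, zero_mul])
  apply mul_right_cancel₀ (mul_ne_zero hi hb0)
  linear_combination (-formVal ι a ha (G i)) * h l +
    formVal g b hb (MvPolynomial.X i) * formVal ι a ha (G b) * (e2 l).symm +
    formVal ι a ha (G l) * h i

/-- Any two morphisms to the zero-dimensional projective space are equal. -/
lemma hom_ext_zero {f g : X ⟶ ProjSpace k 0} (h : f ≫ str k 0 = g ≫ str k 0) : f = g := by
  have hle : ∀ f : X ⟶ ProjSpace k 0, ⊤ ≤ f ⁻¹ᵁ chart k 0 0 := by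
    intro f x _
    obtain ⟨i, hi⟩ := exists_mem_chart (k := k) (f x)
    rwa [Fin.fin_one_eq_zero i] at hi
  refine hom_ext_of_coord h (W := ⊤) _root_.trivial (hle f) (hle g) fun l => ?_
  rw [Fin.fin_one_eq_zero l, coordSec_self, map_one, map_one, one_mul]

end ProjSpace

open LineBundle in
/-- Let `X` be a projective variety over an infinite field `k`, `φ : X → X` a
morphism and `L` a very ample line bundle with `φ*(L) ≅ L^{⊗d}`, `d > 1`. Suppose that the
embedding `ι : X → ℙ(V)` induced by `L` (where `V = H⁰(X, L)`, so `dim V = N + 1`) is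
projectively normal, i.e. `H⁰(ℙ(V), O(n)) → H⁰(X, L^{⊗n})` is surjective for all `n ≥ 0`,
and that `ι(X)` is cut out set-theoretically by homogeneous forms of degree `≤ d`. Then
there is a morphism `ψ : ℙ(V) → ℙ(V)` with `ψ ∘ ι = ι ∘ φ`. -/
theorem stmt_0 {k : Type u} [Field k] [Infinite k] {X : Scheme.{u}} [IsIntegral X]
    (sX : X ⟶ Spec (CommRingCat.of k))
    (φ : X ⟶ X) (hφ : φ ≫ sX = sX)
    (L : LineBundle X) (d : ℕ) (hd : 1 < d)
    (hpull : (LineBundle.pullbackLB φ L).EquivLB (L.pow d))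
    (N : ℕ) (hV : h0 sX L = N + 1)
    (O1 : LineBundle (ProjSpace k N)) (hO1 : IsTautologicalBundle k N O1)
    -- the embedding induced by `L`:
    (ι : X ⟶ ProjSpace k N) (hcl : IsClosedImmersion ι)
    (hιk : ι ≫ ProjSpace.str k N = sX)
    (hind : (LineBundle.pullbackLB ι O1).EquivLB L)
    -- (1) projective normality:
    (hsurj : ∀ n : ℕ, Function.Surjective
      (fun σ : GlobalSec (O1.pow n) => pullbackSec ι (O1.pow n) σ))
    -- (2) `ι(X)` is cut out set-theoretically by forms of degree `≤ d`:
    (hcut : Set.range ι.base = ProjectiveSpectrum.zeroLocus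
      (MvPolynomial.homogeneousSubmodule (Fin (N + 1)) k)
      {f : MvPolynomial (Fin (N + 1)) k |
        (∃ e : ℕ, e ≤ d ∧ f ∈ MvPolynomial.homogeneousSubmodule (Fin (N + 1)) k e) ∧
        ∀ x ∈ Set.range ι.base, f ∈ x.asHomogeneousIdeal}) :
    ∃ ψ : ProjSpace k N ⟶ ProjSpace k N,
      ψ ≫ ProjSpace.str k N = ProjSpace.str k N ∧ φ ≫ ι = ι ≫ ψ := by
  have hstr : (φ ≫ ι) ≫ ProjSpace.str k N = ι ≫ ProjSpace.str k N := by
    rw [Category.assoc, hιk, hφ]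
  rcases Nat.eq_zero_or_pos N with rfl | hN
  · exact ⟨𝟙 _, Category.id_comp _, by
      rw [Category.comp_id]; exact ProjSpace.hom_ext_zero hstr⟩
  obtain ⟨F, hF, hF0, hFval⟩ :=
    ProjSpace.exists_lift_forms hN hO1 φ ι hpull hind (hsurj d)
  obtain ⟨h, hh, hhT, hG0⟩ := ProjSpace.exists_forms_without_zeros hcut (F := F)
    (by rintro _ ⟨x, rfl⟩; exact hF0 x)
  have hG : ∀ l, (F l + h l).IsHomogeneous d := fun l => (hF l).add (hh l)
  obtain ⟨ψ, hψ, hψG⟩ := ProjSpace.exists_hom_of_forms hG hG0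
  obtain ⟨a, ha⟩ := ProjSpace.exists_mem_chart (k := k) (ι (genericPoint X))
  obtain ⟨b, hb⟩ := ProjSpace.exists_mem_chart (k := k) ((φ ≫ ι) (genericPoint X))
  refine ⟨ψ, hψ, ProjSpace.eq_comp_of_formVal hG hψ hψG hstr ha hb ?_ ?_⟩
  · obtain ⟨i, hi⟩ := hG0 (ι (genericPoint X))
    exact ⟨i, (ProjSpace.formVal_ne_zero_iff ι a ha (hG i)).2 hi⟩
  · have h0 : ∀ l, ProjSpace.formVal ι a ha (h l) = 0 := fun l => by
      by_contra hl
      exact (ProjSpace.formVal_ne_zero_iff ι a ha (hh l)).1 hl (hhT l _ ⟨_, rfl⟩)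
    intro l
    rw [map_add, map_add, h0, h0, add_zero, add_zero]
    exact hFval a ha b hb l
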